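/- arXiv:1401.3702 — 2 statements merged into one kernel-verified Lean document; each statement's English description precedes it below -/
import Mathlib

section
/- Let q = 2^n and let ℓ ≥ 3 be odd with either n even or ℓ ≡ ±1 (mod 8); set r = (ℓ+1)/2. Let K = {(x : y : 1) : x, y ∈ F_{q^ℓ}, T(y) = T(x^{q^r+1})} ∪ {(0:1:0)} and K̄ = {(1 : B : 0) : B ∈ F_{q^ℓ}, T(B) = 0}. Then the pointset K₁ = K ∪ K̄ is a complete (N₁, d)-arc in PG(2, q^ℓ) with N₁ = q^{2ℓ−1} + 1 + q^{ℓ−1} and d = q^{ℓ−1} + q^{r−1}. -/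
open Finset

section CurveCounting

variable {k F : Type*} [Field k] [Fintype k] [Field F] [Fintype F] [Algebra k F]

lemma trace_pow_card_pow (x : F) (j : ℕ) :
    Algebra.trace k F (x ^ Fintype.card k ^ j) = Algebra.trace k F x := by
  induction j with
  | zero => simp
  | succ j ih =>
    rw [pow_succ, pow_mul, ← ih]
    exact Algebra.trace_eq_of_algEquiv (FiniteField.frobeniusAlgEquivOfAlgebraic k F)
      (x ^ Fintype.card k ^ j)

lemma mem_range_algebraMap_of_pow_card_eq {x : F} (hx : x ^ Fintype.card k = x) :
    ∃ c : k, algebraMap k F c = x := by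
  have h := (IsGalois.mem_range_algebraMap_iff_fixed (F := k) (E := F) x).2 (by
    intro f
    obtain ⟨i, rfl⟩ := (FiniteField.bijective_frobeniusAlgEquivOfAlgebraic_pow k F).2 f
    rw [AlgEquiv.coe_pow, FiniteField.coe_frobeniusAlgEquivOfAlgebraic_iterate]
    generalize (i : ℕ) = m
    change x ^ Fintype.card k ^ m = x
    induction m with
    | zero => simp
    | succ m ih => rw [pow_succ, pow_mul, ih, hx])
  exact h

open Classical in
lemma card_filter_mul_of_surjective {G H : Type*} [AddGroup G] [Fintype G] [AddGroup H]
    [Fintype H] (f : G →+ H) (hf : Function.Surjective f) (t : H) :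
    #{x | f x = t} * Fintype.card H = Fintype.card G := by
  have h := Finset.card_eq_sum_card_fiberwise (s := (univ : Finset G)) (t := univ) (f := f)
    (fun _ _ => by simp)
  rw [Finset.sum_congr rfl
    (fun u _ => AddMonoidHom.card_fiber_eq_of_mem_range f (hf u) (hf t))] at h
  simpa [mul_comm] using h.symm

lemma trace_mul_surjective {w : F} (hw : w ≠ 0) :
    Function.Surjective (fun x : F => Algebra.trace k F (w * x)) := by
  intro t
  obtain ⟨x, hx⟩ := Algebra.trace_surjective k F t
  exact ⟨w⁻¹ * x, by simpa [hw] using hx⟩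

open Classical in
lemma card_trace_mul_eq {s : ℕ} (hF : Fintype.card F = Fintype.card k ^ (2 * s + 1)) {w : F}
    (hw : w ≠ 0) (t : k) :
    #{x : F | Algebra.trace k F (w * x) = t} = Fintype.card k ^ (2 * s) := by
  have h := card_filter_mul_of_surjective
    ((Algebra.trace k F).toAddMonoidHom.comp (AddMonoidHom.mulLeft w))
    (trace_mul_surjective hw) t
  rw [hF, pow_succ] at h
  exact Nat.eq_of_mul_eq_mul_right Fintype.card_pos h

lemma trace_algebraMap_of_odd [CharP k 2] {s : ℕ}
    (hF : Fintype.card F = Fintype.card k ^ (2 * s + 1)) (c : k) :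
    Algebra.trace k F (algebraMap k F c) = c := by
  have hr : Module.finrank k F = 2 * s + 1 := by
    have := Module.card_eq_pow_finrank (K := k) (V := F)
    rw [hF] at this
    exact (Nat.pow_right_injective Fintype.one_lt_card this).symm
  rw [Algebra.trace_algebraMap, hr]
  have : (2 : k) = 0 := CharTwo.two_eq_zero
  rw [nsmul_eq_mul]; push_cast; rw [this]; ring

section

variable (k) in
/-- The quadratic function `x ↦ Tr (x ^ (q ^ (s + 1) + 1) + B * x)`, where `q = #k`. -/
noncomputable def hermTrace (s : ℕ) (B x : F) : k :=
  Algebra.trace k F (x ^ (Fintype.card k ^ (s + 1) + 1) + B * x)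

variable [CharP k 2] [CharP F 2] {s : ℕ}
  (hF : Fintype.card F = Fintype.card k ^ (2 * s + 1))

lemma card_eq_two_pow : ∃ n, Fintype.card k = 2 ^ n := by
  obtain ⟨n, -, h⟩ := FiniteField.card k 2
  exact ⟨n, h⟩

include hF in
lemma hermTrace_add (B x v : F) :
    hermTrace k s B (x + v) = hermTrace k s B x + hermTrace k s B v +
      Algebra.trace k F ((v ^ Fintype.card k ^ s + v ^ Fintype.card k ^ (s + 1)) * x) := by
  obtain ⟨n, hn⟩ := card_eq_two_pow (k := k)
  have hadd : (x + v) ^ Fintype.card k ^ (s + 1) =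
      x ^ Fintype.card k ^ (s + 1) + v ^ Fintype.card k ^ (s + 1) := by
    rw [hn, ← pow_mul]; exact add_pow_char_pow x v 2 _
  have hx : Algebra.trace k F (v ^ Fintype.card k ^ s * x) =
      Algebra.trace k F (x ^ Fintype.card k ^ (s + 1) * v) := by
    rw [← trace_pow_card_pow (k := k) _ (s + 1), mul_pow, ← pow_mul, ← pow_add,
      show s + (s + 1) = 2 * s + 1 by ring, ← hF, FiniteField.pow_card, mul_comm]
  simp only [hermTrace]
  rw [add_mul, map_add _ (v ^ Fintype.card k ^ s * x), hx, ← map_add, ← map_add, ← map_add,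
    pow_succ, hadd]
  congr 1
  ring

omit [CharP F 2] in
include hF in
lemma hermTrace_algebraMap (B : F) (c : k) :
    hermTrace k s B (algebraMap k F c) = c ^ 2 + Algebra.trace k F B * c := by
  rw [hermTrace, map_add, ← map_pow, trace_algebraMap_of_odd hF, pow_succ, FiniteField.pow_card_pow,
    mul_comm B, ← Algebra.smul_def, map_smul, smul_eq_mul]
  ring

lemma pow_card_pow_add_eq_zero_iff (v : F) :
    v ^ Fintype.card k ^ s + v ^ Fintype.card k ^ (s + 1) = 0 ↔
      ∃ c : k, algebraMap k F c = v := by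
  constructor
  · intro h
    obtain ⟨n, hn⟩ := card_eq_two_pow (k := k)
    apply mem_range_algebraMap_of_pow_card_eq
    rw [CharTwo.add_eq_zero, pow_succ', pow_mul] at h
    have hinj : Function.Injective fun y : F => y ^ Fintype.card k ^ s := by
      rw [hn]; simp_rw [← pow_mul]
      exact iterateFrobenius_inj F 2 (n * s)
    exact (hinj h).symm
  · rintro ⟨c, rfl⟩
    simp only [← map_pow, FiniteField.pow_card_pow, CharTwo.add_self_eq_zero]

include hF in
lemma hermTrace_add_algebraMap (B x : F) (c : k) :
    hermTrace k s B (x + algebraMap k F c) =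
      hermTrace k s B x + (c ^ 2 + Algebra.trace k F B * c) := by
  rw [hermTrace_add hF, (pow_card_pow_add_eq_zero_iff _).2 ⟨c, rfl⟩, hermTrace_algebraMap hF]
  simp

variable (k) in
open Classical in
/-- The number of solutions of `Tr (x ^ (q ^ (s + 1) + 1) + B * x) = t`. -/
noncomputable def hermCount (s : ℕ) (B : F) (t : k) : ℕ := #{x : F | hermTrace k s B x = t}

omit [CharP k 2] [CharP F 2] in
lemma sum_hermCount (B : F) : ∑ t, hermCount k s B t = Fintype.card F := by
  classical
  have h := Finset.card_eq_sum_card_fiberwise (s := (univ : Finset F)) (t := univ)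
    (f := hermTrace k s B) (fun _ _ => by simp)
  rw [card_univ] at h
  rw [h]
  refine sum_congr rfl fun t _ => ?_
  unfold hermCount
  congr

include hF in
lemma hermCount_add (B : F) (t c : k) :
    hermCount k s B (t + (c ^ 2 + Algebra.trace k F B * c)) = hermCount k s B t := by
  symm
  unfold hermCount
  refine card_equiv (Equiv.addRight (algebraMap k F c)) fun x => ?_
  simp [hermTrace_add_algebraMap hF]

include hF in
lemma hermCount_of_trace_eq_zero (B : F) (hB : Algebra.trace k F B = 0) (t : k) :
    hermCount k s B t = Fintype.card k ^ (2 * s) := by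
  have hconst : ∀ u, hermCount k s B u = hermCount k s B t := by
    intro u
    obtain ⟨c, hc⟩ : ∃ c : k, c ^ 2 = u + t :=
      (surjective_frobenius k 2) (u + t)
    have := hermCount_add hF B t c
    rw [hB, zero_mul, add_zero, hc, add_left_comm, CharTwo.add_self_eq_zero, add_zero] at this
    exact this
  have h := sum_hermCount (k := k) (s := s) B
  rw [sum_congr rfl fun u _ => hconst u, sum_const, card_univ, hF, smul_eq_mul, pow_succ'] at h
  exact Nat.eq_of_mul_eq_mul_left Fintype.card_pos h

omit [CharP k 2] [CharP F 2] in
open Classical in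
lemma sum_hermCount_sq_aux (B : F) :
    ∑ t, hermCount k s B t ^ 2 = ∑ v : F, #{x : F | hermTrace k s B (x + v) = hermTrace k s B x} := by
  have h1 : ∀ t, hermCount k s B t ^ 2 = ∑ x : F, if hermTrace k s B x = t then
      hermCount k s B (hermTrace k s B x) else 0 := by
    intro t
    rw [← sum_filter, sum_congr rfl (g := fun _ => hermCount k s B t)
      (fun x hx => by rw [(mem_filter.1 hx).2]), sum_const, smul_eq_mul, sq]
    rfl
  rw [sum_congr rfl fun t _ => h1 t, sum_comm]
  simp only [sum_ite_eq, mem_univ, if_true]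
  simp only [card_filter]
  rw [sum_comm]
  refine sum_congr rfl fun x _ => ?_
  rw [← card_filter]
  unfold hermCount
  symm
  refine card_equiv (Equiv.addLeft x) fun v => ?_
  simp

open Classical in
include hF in
lemma sum_hermCount_sq (B : F) (hB : Algebra.trace k F B ≠ 0) :
    ∑ t, (hermCount k s B t : ℤ) ^ 2 = (Fintype.card k : ℤ) ^ (2 * s + 1) +
      Fintype.card k ^ (4 * s + 1) := by
  have haux := sum_hermCount_sq_aux (k := k) (s := s) B
  set q := Fintype.card k with hq
  set g : F → ℕ := fun v => #{x : F | hermTrace k s B (x + v) = hermTrace k s B x} with hg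
  have hiff : ∀ x v, hermTrace k s B (x + v) = hermTrace k s B x ↔
      Algebra.trace k F ((v ^ q ^ s + v ^ q ^ (s + 1)) * x) = hermTrace k s B v := by
    intro x v
    rw [hermTrace_add hF, add_assoc, add_eq_left, CharTwo.add_eq_zero, eq_comm]
  have hgen : ∀ v, v ∉ univ.image (algebraMap k F) → g v = q ^ (2 * s) := by
    intro v hv
    simp only [hg, hiff]
    refine card_trace_mul_eq hF (fun h0 => hv ?_) _
    obtain ⟨c, hc⟩ := (pow_card_pow_add_eq_zero_iff v).1 h0
    exact mem_image.2 ⟨c, mem_univ _, hc⟩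
  have hspec : ∀ c : k, g (algebraMap k F c) =
      if c = 0 ∨ c = Algebra.trace k F B then q ^ (2 * s + 1) else 0 := by
    intro c
    have : c ^ 2 + Algebra.trace k F B * c = 0 ↔ c = 0 ∨ c = Algebra.trace k F B := by
      rw [show c ^ 2 + Algebra.trace k F B * c = c * (c + Algebra.trace k F B) by ring,
        mul_eq_zero, CharTwo.add_eq_zero]
    simp only [hg, hermTrace_add_algebraMap hF, add_eq_left, this]
    split_ifs with h
    · simp [hF, h]
    · simp [h]
  have hsum : ∑ v, ((g v : ℤ) - q ^ (2 * s)) = q ^ (2 * s + 1) := by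
    rw [← sum_subset (subset_univ (univ.image (algebraMap k F)))
      (fun v _ hv => by rw [hgen v hv]; simp),
      sum_image (fun a _ b _ h => (algebraMap k F).injective h), sum_sub_distrib]
    simp only [hspec]
    push_cast
    rw [← sum_filter, sum_const, sum_const, card_univ, ← hq]
    have : (univ.filter fun c : k => c = 0 ∨ c = Algebra.trace k F B) =
      {0, Algebra.trace k F B} := by ext; simp
    rw [this, card_pair hB.symm]
    simp only [nsmul_eq_mul]; push_cast; ring
  rw [sum_sub_distrib, sum_const, card_univ, hF] at hsum
  have : (∑ t, (hermCount k s B t : ℤ) ^ 2) = ∑ v, (g v : ℤ) := by exact_mod_cast haux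
  rw [this]
  simp only [nsmul_eq_mul] at hsum
  push_cast at hsum
  have e : (q : ℤ) ^ (4 * s + 1) = q ^ (2 * s + 1) * q ^ (2 * s) := by
    rw [← pow_add]; congr 1; ring
  rw [e]; linarith

lemma index_range_sq_add_mul {b : k} (hb : b ≠ 0) :
    ∃ A : AddSubgroup k, (∀ u, u ∈ A ↔ ∃ c, c ^ 2 + b * c = u) ∧ A.index = 2 := by
  let f : k →+ k := (frobenius k 2).toAddMonoidHom + AddMonoidHom.mulLeft b
  have hf : ∀ c, f c = c ^ 2 + b * c := fun c => rfl
  refine ⟨f.range, fun u => by simp [AddMonoidHom.mem_range, hf], ?_⟩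
  rw [AddSubgroup.index_range]
  have : (f.ker : Set k) = {0, b} := by
    ext c
    rw [SetLike.mem_coe, AddMonoidHom.mem_ker, hf, show c ^ 2 + b * c = c * (c + b) by ring,
        mul_eq_zero, CharTwo.add_eq_zero]
    simp
  rw [← Set.ncard_pair hb.symm, ← this]
  rfl

include hF in
lemma hermCount_of_trace_ne_zero (B : F) (hB : Algebra.trace k F B ≠ 0) :
    (∀ t, hermCount k s B t = Fintype.card k ^ (2 * s) + Fintype.card k ^ s ∨
      hermCount k s B t + Fintype.card k ^ s = Fintype.card k ^ (2 * s)) ∧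
    ∃ t, hermCount k s B t = Fintype.card k ^ (2 * s) + Fintype.card k ^ s := by
  classical
  obtain ⟨A, hA, hA2⟩ := index_range_sq_add_mul hB
  set q := Fintype.card k with hq
  have hq0 : (q : ℤ) ≠ 0 := by exact_mod_cast (Fintype.card_pos (α := k)).ne'
  set M : k → ℤ := fun t => hermCount k s B t - q ^ (2 * s) with hM
  have hcoset : ∀ t u, t + u ∈ A → M t = M u := by
    intro t u h
    obtain ⟨c, hc⟩ := (hA _).1 h
    have := hermCount_add hF B u c
    rw [hc, add_comm t u, ← add_assoc, CharTwo.add_self_eq_zero, zero_add] at this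
    simp [hM, this]
  have hsum : ∑ t, M t = 0 := by
    have : (∑ t, (hermCount k s B t : ℤ)) = (q : ℤ) ^ (2 * s + 1) := by
      rw [hq, ← Nat.cast_pow, ← hF]
      exact_mod_cast sum_hermCount (k := k) (s := s) B
    simp only [hM, sum_sub_distrib, this, sum_const, card_univ, ← hq, nsmul_eq_mul]
    ring
  have hsq : ∑ t, M t ^ 2 = q ^ (2 * s + 1) := by
    have h1 := sum_hermCount_sq hF B hB
    have h2 : ∀ t, M t ^ 2 = (hermCount k s B t : ℤ) ^ 2 - 2 * q ^ (2 * s) * M t - q ^ (4 * s) := by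
      intro t
      simp only [hM]
      rw [show 4 * s = 2 * s + 2 * s by ring, pow_add]
      ring
    rw [sum_congr rfl fun t _ => h2 t, sum_sub_distrib, sum_sub_distrib, ← mul_sum, hsum, h1,
      sum_const, card_univ, ← hq, nsmul_eq_mul]
    ring
  obtain ⟨u, hu⟩ : ∃ u, u ∉ A := by
    by_contra! h
    rw [show A = ⊤ from (AddSubgroup.eq_top_iff' A).2 h] at hA2
    simp at hA2
  have hMt : ∀ t, M t = if t ∈ A then M 0 else M u := by
    intro t
    split_ifs with h
    · exact hcoset t 0 (by simpa)
    · exact hcoset t u ((AddSubgroup.add_mem_iff_of_index_two hA2).2 (by simp [h, hu]))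
  have hopp : M u = - M 0 := by
    have h1 : ∑ t, (M t + M (t + u)) = 0 := by
      rw [sum_add_distrib, show ∑ t, M (t + u) = ∑ t, M t from
        Equiv.sum_comp (Equiv.addRight u) M, hsum, add_zero]
    have h2 : ∀ t, M t + M (t + u) = M 0 + M u := by
      intro t
      rw [hMt t, hMt (t + u), AddSubgroup.add_mem_iff_of_index_two hA2]
      by_cases h : t ∈ A <;> simp [h, hu, add_comm]
    rw [sum_congr rfl fun t _ => h2 t, sum_const, card_univ, ← hq, nsmul_eq_mul] at h1
    have := (mul_eq_zero.1 h1).resolve_left hq0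
    linarith
  have hsq0 : ∀ t, M t ^ 2 = M 0 ^ 2 := by
    intro t
    rw [hMt t]
    split_ifs
    · rfl
    · rw [hopp]; ring
  have hM0 : M 0 ^ 2 = (q ^ s) ^ 2 := by
    rw [sum_congr rfl fun t _ => hsq0 t, sum_const, card_univ, ← hq, nsmul_eq_mul,
      pow_succ' (q : ℤ)] at hsq
    rw [mul_left_cancel₀ hq0 hsq]; ring
  refine ⟨fun t => ?_, ?_⟩
  · rcases sq_eq_sq_iff_eq_or_eq_neg.1 ((hsq0 t).trans hM0) with h | h
    · left; zify; simp only [hM] at h; linarith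
    · right; zify; simp only [hM] at h; linarith
  · rcases sq_eq_sq_iff_eq_or_eq_neg.1 hM0 with h | h
    · refine ⟨0, ?_⟩
      zify; simp only [hM] at h; linarith
    · refine ⟨u, ?_⟩
      rw [h] at hopp
      zify; simp only [hM] at hopp; linarith

open Classical in
include hF in
lemma sum_hermCount_pencil (a : F) (τ : k) (hτ : hermTrace k s 0 a ≠ τ) :
    ∑ B : F, hermCount k s B (τ + Algebra.trace k F (B * a)) =
      (Fintype.card F - 1) * Fintype.card k ^ (2 * s) := by
  simp only [hermCount, card_filter]
  rw [sum_comm]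
  have h : ∀ x : F, (∑ B : F, if hermTrace k s B x = τ + Algebra.trace k F (B * a) then 1 else 0)
      = if x = a then 0 else Fintype.card k ^ (2 * s) := by
    intro x
    have hiff : ∀ B, hermTrace k s B x = τ + Algebra.trace k F (B * a) ↔
        Algebra.trace k F ((x + a) * B) = hermTrace k s 0 x + τ := by
      intro B
      have e : hermTrace k s B x = hermTrace k s 0 x + Algebra.trace k F (B * x) := by
        simp [hermTrace]
      rw [e, add_mul, map_add, mul_comm x, mul_comm a, ← CharTwo.add_eq_zero, eq_comm,
        ← CharTwo.add_eq_zero (R := k) (b := _ + τ), eq_comm]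
      constructor <;> intro h <;> rw [← h] <;> ring
    simp only [hiff]
    rw [← card_filter]
    split_ifs with hx
    · subst hx
      have h0 : ¬ 0 = hermTrace k s 0 x + τ := fun h => hτ (CharTwo.add_eq_zero.1 h.symm)
      simp [CharTwo.add_self_eq_zero, h0]
    · exact card_trace_mul_eq hF (fun h => hx (CharTwo.add_eq_zero.1 h)) _
  rw [sum_congr rfl fun x _ => h x, sum_ite, sum_const_zero, zero_add, sum_const, smul_eq_mul,
    filter_ne', card_erase_of_mem (mem_univ _), card_univ]

include hF in
lemma exists_hermCount_pencil (hs : 1 ≤ s) (a : F) (τ : k) (hτ : hermTrace k s 0 a ≠ τ) :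
    ∃ B : F, Algebra.trace k F B ≠ 0 ∧
      hermCount k s B (τ + Algebra.trace k F (B * a)) =
        Fintype.card k ^ (2 * s) + Fintype.card k ^ s := by
  classical
  by_contra! hcon
  have hsum := sum_hermCount_pencil hF a τ hτ
  set q := Fintype.card k with hq
  have hq1 : 1 < q := Fintype.one_lt_card
  have hval : ∀ B : F, (hermCount k s B (τ + Algebra.trace k F (B * a)) : ℤ) =
      (q ^ (2 * s) - q ^ s) + if Algebra.trace k F B = 0 then (q : ℤ) ^ s else 0 := by
    intro B
    split_ifs with hB
    · rw [hermCount_of_trace_eq_zero hF B hB]; push_cast; ring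
    · have := ((hermCount_of_trace_ne_zero hF B hB).1 _).resolve_left (hcon B hB)
      zify at this; linarith
  have hcard : #{B : F | Algebra.trace k F B = 0} = q ^ (2 * s) := by
    simpa using card_trace_mul_eq hF (one_ne_zero (α := F)) (0 : k)
  zify [Fintype.card_pos (α := F)] at hsum
  rw [sum_congr rfl fun B _ => hval B, sum_add_distrib, ← sum_filter, sum_const, sum_const, hcard,
    card_univ, hF] at hsum
  simp only [nsmul_eq_mul] at hsum
  push_cast at hsum
  have h2 : (q : ℤ) ^ (2 * s) * (q ^ s * (q - 1)) = q ^ (2 * s) * 1 := by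
    linear_combination -hsum
  have hq0 : (q : ℤ) ^ (2 * s) ≠ 0 := by positivity
  have h3 := mul_left_cancel₀ hq0 h2
  have h4 : (2 : ℤ) ≤ q ^ s := by
    calc (2 : ℤ) ≤ q := by exact_mod_cast hq1
      _ = q ^ 1 := (pow_one _).symm
      _ ≤ q ^ s := pow_le_pow_right₀ (by exact_mod_cast hq1.le) hs
  have h5 : (1 : ℤ) ≤ q - 1 := by have : (2 : ℤ) ≤ q := by exact_mod_cast hq1
                                  linarith
  nlinarith

end

end CurveCounting

section PlanePoints

variable {F : Type*} [Field F]

/-- The points of the projective plane in normalized coordinates: the affine points `(x : y : 1)`,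
the points `(1 : B : 0)`, and `(0 : 1 : 0)`. -/
noncomputable def planePoint : (F × F) ⊕ (F ⊕ Unit) → Projectivization F (Fin 3 → F)
  | .inl (x, y) => Projectivization.mk F ![x, y, 1] (fun h => one_ne_zero (congrFun h 2))
  | .inr (.inl B) => Projectivization.mk F ![1, B, 0] (fun h => one_ne_zero (congrFun h 0))
  | .inr (.inr _) => Projectivization.mk F ![0, 1, 0] (fun h => one_ne_zero (congrFun h 1))

lemma planePoint_injective : Function.Injective (planePoint (F := F)) := by
  rintro (⟨x, y⟩ | B | _) (⟨x', y'⟩ | B' | _) h <;>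
    obtain ⟨a, ha⟩ := (Projectivization.mk_eq_mk_iff' F _ _ _ _).1 h <;>
    have h0 := congrFun ha 0 <;> have h1 := congrFun ha 1 <;> have h2 := congrFun ha 2 <;>
    simp at h0 h1 h2 <;> simp_all

lemma planePoint_surjective : Function.Surjective (planePoint (F := F)) := by
  intro P
  induction P using Projectivization.ind with
  | h v hv =>
    by_cases h2 : v 2 = 0
    · by_cases h0 : v 0 = 0
      · have h1 : v 1 ≠ 0 := fun h1 => hv (by ext i; fin_cases i <;> simpa)
        refine ⟨.inr (.inr ()), ?_⟩
        rw [planePoint, Projectivization.mk_eq_mk_iff']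
        exact ⟨(v 1)⁻¹, by ext i; fin_cases i <;> simp [h0, h1, h2]⟩
      · refine ⟨.inr (.inl (v 1 / v 0)), ?_⟩
        rw [planePoint, Projectivization.mk_eq_mk_iff']
        exact ⟨(v 0)⁻¹, by ext i; fin_cases i <;> simp [h0, h2]; field_simp⟩
    · refine ⟨.inl (v 0 / v 2, v 1 / v 2), ?_⟩
      rw [planePoint, Projectivization.mk_eq_mk_iff']
      exact ⟨(v 2)⁻¹, by ext i; fin_cases i <;> simp [h2] <;> field_simp⟩

lemma rep_mk_incident_iff (v : Fin 3 → F) (hv : v ≠ 0) (α β γ : F) :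
    α * (Projectivization.mk F v hv).rep 0 + β * (Projectivization.mk F v hv).rep 1 +
      γ * (Projectivization.mk F v hv).rep 2 = 0 ↔ α * v 0 + β * v 1 + γ * v 2 = 0 := by
  obtain ⟨a, ha⟩ := Projectivization.exists_smul_eq_mk_rep F v hv
  rw [← ha]
  have : ∀ i, (a • v) i = a * v i := fun i => rfl
  simp only [this]
  rw [show α * (a * v 0) + β * (a * v 1) + γ * (a * v 2) =
    a * (α * v 0 + β * v 1 + γ * v 2) by ring]
  simp

open Classical in
lemma natCard_eq_planePoint [Finite F] (S : Set (Projectivization F (Fin 3 → F))) :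
    Nat.card S = Nat.card {p : F × F // planePoint (.inl p) ∈ S} +
      (Nat.card {B : F // planePoint (.inr (.inl B)) ∈ S} +
        if planePoint (F := F) (.inr (.inr ())) ∈ S then 1 else 0) := by
  rw [← Nat.card_congr ((Equiv.ofBijective _
    ⟨planePoint_injective (F := F), planePoint_surjective⟩).subtypeEquiv
      (p := fun p => planePoint p ∈ S) (q := fun P => P ∈ S) fun _ => Iff.rfl),
    Nat.card_congr Equiv.subtypeSum, Nat.card_sum, Nat.card_congr Equiv.subtypeSum, Nat.card_sum]
  congr 2
  split_ifs with h
  · have : Unique {b : Unit // planePoint (F := F) (.inr (.inr b)) ∈ S} :=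
      ⟨⟨⟨(), h⟩⟩, fun _ => Subtype.ext rfl⟩
    exact Nat.card_unique
  · have : IsEmpty {b : Unit // planePoint (F := F) (.inr (.inr b)) ∈ S} := ⟨fun b => h b.2⟩
    exact Nat.card_of_isEmpty

lemma natCard_graph (P : F × F → Prop) (B C : F) :
    Nat.card {p : F × F // P p ∧ p.2 = B * p.1 + C} = Nat.card {x : F // P (x, B * x + C)} :=
  Nat.card_congr
    { toFun := fun p => ⟨p.1.1, by have := p.2.1; rwa [← p.2.2]⟩
      invFun := fun x => ⟨(x.1, B * x.1 + C), x.2, rfl⟩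
      left_inv := fun p => Subtype.ext (Prod.ext rfl p.2.2.symm)
      right_inv := fun _ => rfl }

omit [Field F] in
lemma natCard_vertical (P : F × F → Prop) (c : F) :
    Nat.card {p : F × F // P p ∧ p.1 = c} = Nat.card {y : F // P (c, y)} :=
  Nat.card_congr
    { toFun := fun p => ⟨p.1.2, by obtain ⟨_, h, rfl⟩ := p; exact h⟩
      invFun := fun y => ⟨(c, y.1), y.2, rfl⟩
      left_inv := fun p => Subtype.ext (Prod.ext p.2.2.symm rfl)
      right_inv := fun _ => rfl }

end PlanePoints

section Arc

variable {k F : Type*} [Field k] [Fintype k] [Field F] [Fintype F] [Algebra k F]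

variable (k F) in
/-- The affine points of the generalized Hermitian curve together with `(0 : 1 : 0)` and the
points `(1 : B : 0)` with `Tr B = 0`. -/
def hermArc (s : ℕ) : Set (Projectivization F (Fin 3 → F)) :=
  planePoint '' {p | p.elim (fun a => Algebra.trace k F a.2 = hermTrace k s 0 a.1)
    (fun b => b.elim (fun B => Algebra.trace k F B = 0) fun _ => True)}

/-- The line `α X + β Y + γ Z = 0`. -/
def planeLine (α β γ : F) : Set (Projectivization F (Fin 3 → F)) :=
  {P | α * P.rep 0 + β * P.rep 1 + γ * P.rep 2 = 0}

omit [Fintype F] in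
lemma inl_mem_hermArc {s : ℕ} {p : F × F} : planePoint (.inl p) ∈ hermArc k F s ↔
    Algebra.trace k F p.2 = hermTrace k s 0 p.1 := by
  rw [hermArc, planePoint_injective.mem_set_image]; rfl

omit [Fintype F] in
lemma inr_inl_mem_hermArc {s : ℕ} {B : F} : planePoint (.inr (.inl B)) ∈ hermArc k F s ↔
    Algebra.trace k F B = 0 := by
  rw [hermArc, planePoint_injective.mem_set_image]; rfl

omit [Fintype F] in
lemma inr_inr_mem_hermArc {s : ℕ} {u : Unit} : planePoint (.inr (.inr u)) ∈ hermArc k F s := by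
  rw [hermArc, planePoint_injective.mem_set_image]; trivial

omit [Fintype F] in
lemma inl_mem_planeLine {α β γ : F} {p : F × F} : planePoint (.inl p) ∈ planeLine α β γ ↔
    α * p.1 + β * p.2 + γ = 0 := by
  simp [planeLine, planePoint, rep_mk_incident_iff]

omit [Fintype F] in
lemma inr_inl_mem_planeLine {α β γ B : F} : planePoint (.inr (.inl B)) ∈ planeLine α β γ ↔
    α + β * B = 0 := by
  simp [planeLine, planePoint, rep_mk_incident_iff]

omit [Fintype F] in
lemma inr_inr_mem_planeLine {α β γ : F} {u : Unit} :
    planePoint (.inr (.inr u)) ∈ planeLine α β γ ↔ β = 0 := by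
  simp [planeLine, planePoint, rep_mk_incident_iff]

variable [CharP k 2] [CharP F 2] {s : ℕ}
  (hF : Fintype.card F = Fintype.card k ^ (2 * s + 1))

omit [CharP k 2] [CharP F 2] in
include hF in
lemma natCard_trace_eq (t : k) :
    Nat.card {y : F // Algebra.trace k F y = t} = Fintype.card k ^ (2 * s) := by
  classical
  rw [Nat.card_eq_fintype_card, Fintype.card_subtype]
  simpa using card_trace_mul_eq hF (one_ne_zero (α := F)) t

omit [CharP k 2] [CharP F 2] in
include hF in
lemma natCard_hermArc : Nat.card (hermArc k F s) =
    Fintype.card k ^ (4 * s + 1) + 1 + Fintype.card k ^ (2 * s) := by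
  rw [natCard_eq_planePoint]
  simp only [inl_mem_hermArc, inr_inl_mem_hermArc, inr_inr_mem_hermArc, if_true]
  have h1 : Nat.card {p : F × F // Algebra.trace k F p.2 = hermTrace k s 0 p.1} =
      Fintype.card k ^ (4 * s + 1) := by
    rw [Nat.card_congr (Equiv.subtypeProdEquivSigmaSubtype
      fun x y => Algebra.trace k F y = hermTrace k s 0 x), Nat.card_sigma]
    simp only [natCard_trace_eq hF]
    rw [sum_const, card_univ, hF, smul_eq_mul, ← pow_add]
    congr 1; ring
  rw [h1, natCard_trace_eq hF]
  ring

open Classical in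
lemma natCard_hermArc_inter_line (B C : F) :
    Nat.card ↥(hermArc k F s ∩ planeLine B 1 C) =
      hermCount k s B (Algebra.trace k F C) + if Algebra.trace k F B = 0 then 1 else 0 := by
  rw [natCard_eq_planePoint]
  simp only [Set.mem_inter_iff, inl_mem_hermArc, inr_inl_mem_hermArc, inr_inr_mem_hermArc,
    inl_mem_planeLine, inr_inl_mem_planeLine, inr_inr_mem_planeLine, one_ne_zero, and_false,
    if_false, add_zero, one_mul]
  congr 1
  · have : ∀ p : F × F, B * p.1 + p.2 + C = 0 ↔ p.2 = B * p.1 + C := by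
      intro p
      rw [show B * p.1 + p.2 + C = p.2 + (B * p.1 + C) by ring, CharTwo.add_eq_zero]
    simp only [this]
    rw [natCard_graph (fun p => Algebra.trace k F p.2 = hermTrace k s 0 p.1),
      Nat.card_eq_fintype_card, Fintype.card_subtype, hermCount]
    congr 1
    ext x
    simp only [mem_filter, mem_univ, true_and, hermTrace, map_add, zero_mul, add_zero]
    rw [← CharTwo.add_eq_zero, ← CharTwo.add_eq_zero (R := k) (b := Algebra.trace k F C)]
    refine Eq.congr_left ?_
    ring
  · have : ∀ b : F, (Algebra.trace k F b = 0 ∧ B + b = 0) ↔ (Algebra.trace k F B = 0 ∧ b = B) := by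
      intro b
      rw [CharTwo.add_eq_zero]
      constructor <;> rintro ⟨h, rfl⟩ <;> exact ⟨h, rfl⟩
    simp only [this]
    split_ifs with h <;> simp [h]

include hF in
lemma natCard_hermArc_inter_le {α β γ : F} (h : (α, β, γ) ≠ (0, 0, 0)) :
    Nat.card ↥(hermArc k F s ∩ planeLine α β γ) ≤
      Fintype.card k ^ (2 * s) + Fintype.card k ^ s := by
  classical
  have hpos : 1 ≤ Fintype.card k ^ s := Nat.one_le_pow _ _ Fintype.card_pos
  by_cases hβ : β = 0
  · subst hβ
    rw [natCard_eq_planePoint]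
    simp only [Set.mem_inter_iff, inl_mem_hermArc, inr_inl_mem_hermArc, inr_inr_mem_hermArc,
      inl_mem_planeLine, inr_inl_mem_planeLine, inr_inr_mem_planeLine, and_self, if_true,
      zero_mul, add_zero]
    by_cases hα : α = 0
    · subst hα
      have hγ : γ ≠ 0 := fun hγ => h (by rw [hγ])
      simp only [zero_mul, zero_add, hγ, and_false, and_true, natCard_trace_eq hF,
        Nat.card_of_isEmpty]
      omega
    · have : ∀ p : F × F, α * p.1 + γ = 0 ↔ p.1 = γ / α := by
        intro p
        rw [CharTwo.add_eq_zero, eq_div_iff hα, mul_comm]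
      simp only [this]
      rw [natCard_vertical (fun p => Algebra.trace k F p.2 = hermTrace k s 0 p.1)]
      simp only [hα, and_false, natCard_trace_eq hF, Nat.card_of_isEmpty]
      omega
  · have hline : planeLine α β γ = planeLine (α / β) 1 (γ / β) := by
      ext P
      simp only [planeLine, Set.mem_ofPred_eq]
      rw [show α * P.rep 0 + β * P.rep 1 + γ * P.rep 2 =
        β * (α / β * P.rep 0 + 1 * P.rep 1 + γ / β * P.rep 2) by field_simp]
      simp [hβ]
    rw [hline, natCard_hermArc_inter_line]
    split_ifs with hB
    · rw [hermCount_of_trace_eq_zero hF _ hB]; omega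
    · rcases (hermCount_of_trace_ne_zero hF _ hB).1 (Algebra.trace k F (γ / β)) with h | h <;> omega

include hF in
lemma exists_natCard_hermArc_inter_eq (hs : 1 ≤ s) {P : Projectivization F (Fin 3 → F)}
    (hP : P ∉ hermArc k F s) : ∃ B C : F, P ∈ planeLine B 1 C ∧
      Nat.card ↥(hermArc k F s ∩ planeLine B 1 C) =
        Fintype.card k ^ (2 * s) + Fintype.card k ^ s := by
  simp only [natCard_hermArc_inter_line]
  obtain ⟨(⟨a, b⟩ | B | _), rfl⟩ := planePoint_surjective P
  · rw [inl_mem_hermArc] at hP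
    obtain ⟨B, hB, hN⟩ := exists_hermCount_pencil hF hs a (Algebra.trace k F b) (Ne.symm hP)
    refine ⟨B, b + B * a, ?_, ?_⟩
    · rw [inl_mem_planeLine, show B * a + 1 * b + (b + B * a) = (b + B * a) + (b + B * a) by ring,
        CharTwo.add_self_eq_zero]
    · rw [map_add, hN, if_neg hB, add_zero]
  · rw [inr_inl_mem_hermArc] at hP
    obtain ⟨t, ht⟩ := (hermCount_of_trace_ne_zero hF B hP).2
    obtain ⟨C, rfl⟩ := Algebra.trace_surjective k F t
    refine ⟨B, C, ?_, by rw [ht, if_neg hP, add_zero]⟩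
    rw [inr_inl_mem_planeLine, one_mul, CharTwo.add_self_eq_zero]
  · exact absurd inr_inr_mem_hermArc hP

end Arc

lemma exists_algebra_of_card_eq {n ℓ : ℕ} (hn : 1 ≤ n) (F : Type) [Field F] [Fintype F]
    [CharP F 2] (hF : Fintype.card F = (2 ^ n) ^ ℓ) :
    Nonempty (GaloisField 2 n →+* F) := by
  let : Algebra (ZMod 2) F := ZMod.algebra F 2
  have hr : Module.finrank (ZMod 2) F = n * ℓ := by
    have := Module.card_eq_pow_finrank (K := ZMod 2) (V := F)
    rw [hF, ZMod.card, ← pow_mul] at this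
    exact (Nat.pow_right_injective le_rfl this).symm
  obtain ⟨f⟩ := FiniteField.nonempty_algHom_of_finrank_dvd (F := ZMod 2) (K := GaloisField 2 n)
    (L := F) (by rw [GaloisField.finrank 2 (by omega), hr]; exact dvd_mul_right _ _)
  exact ⟨f.toRingHom⟩

/-- Let `q = 2 ^ n`, `ℓ ≥ 3` odd with `n` even or `ℓ ≡ ±1 (mod 8)`, and
`r = (ℓ+1)/2`.  With `K` the set of rational points of the generalized Hermitian curve and
`K̄ = {(1 : B : 0) : T B = 0}`, the pointset `K₁ = K ∪ K̄` is a complete `(N₁, d)`-arc in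
`PG(2, q^ℓ)` with `N₁ = q^(2ℓ-1) + 1 + q^(ℓ-1)` and `d = q^(ℓ-1) + q^(r-1)`. -/
theorem stmt_16 (n : ℕ) (hn : 1 ≤ n) (q : ℕ) (hq : q = 2 ^ n)
    (ℓ r : ℕ) (hℓ : 3 ≤ ℓ) (hlo : Odd ℓ)
    (hcase : Even n ∨ ℓ % 8 = 1 ∨ ℓ % 8 = 7)
    (hr : r = (ℓ + 1) / 2)
    (F : Type) [Field F] [Fintype F] (hF : Fintype.card F = q ^ ℓ)
    (T : F → F) (hT : ∀ z : F, T z = ∑ i ∈ Finset.range ℓ, z ^ q ^ i)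
    (K Kbar K₁ : Set (Projectivization F (Fin 3 → F)))
    (hK : K = {P | ∃ x y : F, T y = T (x ^ (q ^ r + 1)) ∧
          P = Projectivization.mk F ![x, y, 1]
            (fun h => one_ne_zero (congrFun h 2))} ∪
        {Projectivization.mk F ![0, 1, 0]
            (fun h => one_ne_zero (congrFun h 1))})
    (hKbar : Kbar = {P | ∃ B : F, T B = 0 ∧
          P = Projectivization.mk F ![1, B, 0]
            (fun h => one_ne_zero (congrFun h 0))})
    (hK₁ : K₁ = K ∪ Kbar) :
    Nat.card ↥K₁ = q ^ (2 * ℓ - 1) + 1 + q ^ (ℓ - 1) ∧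
    (∀ α β γ : F, (α, β, γ) ≠ (0, 0, 0) →
      Nat.card ↥(K₁ ∩ {P : Projectivization F (Fin 3 → F) |
          α * P.rep 0 + β * P.rep 1 + γ * P.rep 2 = 0})
        ≤ q ^ (ℓ - 1) + q ^ (r - 1)) ∧
    (∀ P : Projectivization F (Fin 3 → F), P ∉ K₁ → ∃ α β γ : F,
      (α, β, γ) ≠ (0, 0, 0) ∧ α * P.rep 0 + β * P.rep 1 + γ * P.rep 2 = 0 ∧
      Nat.card ↥(K₁ ∩ {Q : Projectivization F (Fin 3 → F) |
          α * Q.rep 0 + β * Q.rep 1 + γ * Q.rep 2 = 0})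
        = q ^ (ℓ - 1) + q ^ (r - 1)) := by

  classical
  subst hq
  obtain ⟨s, rfl⟩ := hlo
  obtain rfl : r = s + 1 := by omega
  have hs : 1 ≤ s := by omega
  have : CharP F 2 := by
    obtain ⟨p, hp⟩ := CharP.exists F
    have := hp
    obtain ⟨m, hprime, hm⟩ := FiniteField.card F p
    have h2 : p ∣ 2 := by
      have : p ∣ (2 ^ n) ^ (2 * s + 1) := by
        rw [← hF, hm]; exact dvd_pow_self p m.ne_zero
      exact hprime.dvd_of_dvd_pow (hprime.dvd_of_dvd_pow this)
    rwa [(Nat.prime_dvd_prime_iff_eq hprime Nat.prime_two).1 h2] at hp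
  obtain ⟨f⟩ := exists_algebra_of_card_eq hn F hF
  let : Algebra (GaloisField 2 n) F := f.toAlgebra
  let : Fintype (GaloisField 2 n) := Fintype.ofFinite _
  have hk : Fintype.card (GaloisField 2 n) = 2 ^ n := by
    rw [Fintype.card_eq_nat_card, GaloisField.card 2 n (by omega)]
  have hF' : Fintype.card F = Fintype.card (GaloisField 2 n) ^ (2 * s + 1) := by rw [hk, hF]
  have hfin : Module.finrank (GaloisField 2 n) F = 2 * s + 1 := by
    have := Module.card_eq_pow_finrank (K := GaloisField 2 n) (V := F)
    rw [hF'] at this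
    exact (Nat.pow_right_injective Fintype.one_lt_card this).symm
  have hTtr : ∀ z, T z = algebraMap (GaloisField 2 n) F (Algebra.trace (GaloisField 2 n) F z) := by
    intro z
    rw [hT, FiniteField.algebraMap_trace_eq_sum_pow, hfin, GaloisField.card 2 n (by omega)]
  have hinj := (algebraMap (GaloisField 2 n) F).injective
  obtain rfl : K₁ = hermArc (GaloisField 2 n) F s := by
    subst hK₁ hK hKbar
    have hmk : ∀ P : Projectivization F (Fin 3 → F), (P ∈ ({P | ∃ x y : F,
        T y = T (x ^ ((2 ^ n) ^ (s + 1) + 1)) ∧ P = planePoint (.inl (x, y))} ∪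
        {planePoint (.inr (.inr ()))} ∪ {P | ∃ B : F, T B = 0 ∧ P = planePoint (.inr (.inl B))} :
        Set (Projectivization F (Fin 3 → F))) ↔ P ∈ hermArc (GaloisField 2 n) F s) := by
      intro P
      obtain ⟨p, rfl⟩ := planePoint_surjective P
      simp only [Set.mem_union, Set.mem_ofPred_eq, Set.mem_singleton_iff,
        planePoint_injective.eq_iff, hTtr, hinj.eq_iff, map_eq_zero]
      rcases p with ⟨x, y⟩ | B | _
      · rw [inl_mem_hermArc, hermTrace, hk]
        simp
      · rw [inr_inl_mem_hermArc]
        simp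
      · simp [inr_inr_mem_hermArc]
    exact Set.ext hmk
  refine ⟨?_, fun α β γ h => ?_, fun P hP => ?_⟩
  · rw [natCard_hermArc hF', hk, show 2 * (2 * s + 1) - 1 = 4 * s + 1 by omega, Nat.add_sub_cancel]
  · have := natCard_hermArc_inter_le hF' h
    rw [hk] at this
    exact this
  · obtain ⟨B, C, hmem, hcard⟩ := exists_natCard_hermArc_inter_eq hF' hs hP
    rw [hk] at hcard
    exact ⟨B, 1, C, by simp, hmem, hcard⟩
end

section
/- Let q = 2^n and let ℓ ≥ 6 with ℓ ≡ 2 (mod 4); set r = ℓ/2 + 2. Let K = {(x : y : 1) : x, y ∈ F_{q^ℓ}, T(y) = T(x^{q^r+1})} ∪ {(0:1:0)}, and let H = {B ∈ F_{q^ℓ} : the equation x^{q^{2r}} + x = B^{q^r} has a solution x ∈ F_{q^ℓ}}. Then for every subset H₂ ⊆ F_{q^ℓ} ∖ H with #H₂ = q^{ℓ−1} + q^{r−2}(q−1) − 1, the pointset K₃ = K ∪ {(1 : B : 0) : B ∈ H₂} is a complete (N₃, d₂)-arc in PG(2, q^ℓ) with N₃ = q^{2ℓ−1} + q^{ℓ−1}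 + q^{r−2}(q−1) and d₂ = q^{ℓ−1} + q^{r−2}(q−1). -/
open Finset in
theorem LinearMap.card_mul_card_filter_eq {k V : Type*} [Field k] [Fintype k] [DecidableEq k]
    [AddCommGroup V] [Fintype V] [Module k V] {g : V →ₗ[k] k} (hg : g ≠ 0) (c : k) :
    Fintype.card k * #{v | g v = c} = Fintype.card V := by
  have hs : ∀ d, ∃ v, g v = d := LinearMap.surjective hg
  have key : ∀ d, #{v | g v = d} = #{v | g v = c} := fun d =>
    AddMonoidHom.card_fiber_eq_of_mem_range g.toAddMonoidHom (hs d) (hs c)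
  have h := Finset.card_eq_sum_card_fiberwise (s := (univ : Finset V)) (t := (univ : Finset k))
    (f := g) (fun _ _ => mem_coe.2 (mem_univ _))
  rw [card_univ] at h
  simp [h, key]

open Finset Classical in
theorem card_mul_card_filter_add_card {k V : Type*} [Field k] [Fintype k]
    [AddCommGroup V] [Fintype V] [Module k V] (A : Submodule k V) (f : V → k)
    (g : V → A →ₗ[k] k) (hfg : ∀ v (a : A), f (v + a) = f v + g v a) (c : k) :
    Fintype.card k * #{v | f v = c} + #{v | g v = 0} =
      Fintype.card V + Fintype.card k * #{v | g v = 0 ∧ f v = c} := by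
  have h1 : Fintype.card A * #{v | f v = c} = ∑ v : V, #{a : A | g v a = c - f v} := by
    have h2 : ∀ a : A, #{v | f (v + a) = c} = #{v | f v = c} := fun a =>
      card_bij (fun v _ => v + a) (by simp) (by simp)
        (fun v hv => ⟨v - a, by simpa using hv, by simp⟩)
    calc Fintype.card A * #{v | f v = c} = ∑ a : A, #{v | f (v + a) = c} := by simp [h2]
      _ = ∑ v : V, #{a : A | f (v + a) = c} := by
        simp only [card_filter]
        exact sum_comm
      _ = _ := by simp only [hfg, eq_sub_iff_add_eq']
  have h3 : ∀ v, Fintype.card k * #{a : A | g v a = c - f v} +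
      (if g v = 0 then Fintype.card A else 0) =
      Fintype.card A + Fintype.card A * Fintype.card k * (if g v = 0 ∧ f v = c then 1 else 0) := by
    intro v
    by_cases hv : g v = 0
    · by_cases hc : f v = c
      · simp [hv, hc]; ring
      · have : ¬ 0 = c - f v := fun h => hc (sub_eq_zero.1 h.symm).symm
        simp [hv, hc, this]
    · simp [hv, LinearMap.card_mul_card_filter_eq hv]
  have h4 := Finset.sum_congr rfl (fun v (_ : v ∈ (univ : Finset V)) => h3 v)
  simp only [sum_add_distrib, ← mul_sum, ← h1, sum_const, card_univ, smul_eq_mul, sum_ite,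
    mul_zero, add_zero] at h4
  have hA : 0 < Fintype.card A := Fintype.card_pos
  refine Nat.eq_of_mul_eq_mul_left hA ?_
  linarith

section
variable {k F : Type*} [Field k] [Field F] [Algebra k F]

/-- The form `x ↦ tr (σ^r x * x)`. -/
noncomputable def hermitianForm (σ : F ≃ₐ[k] F) (r : ℕ) (x : F) : k :=
  Algebra.trace k F ((σ ^ r) x * x)

/-- The polar form of `hermitianForm`. -/
noncomputable def hermitianPolar (σ : F ≃ₐ[k] F) (r : ℕ) : F →ₗ[k] F →ₗ[k] k :=
  LinearMap.mk₂ k (fun x z => Algebra.trace k F ((σ ^ r) x * z + x * (σ ^ r) z))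
    (by intros; simp only [map_add, add_mul]; ring)
    (by intros; simp only [map_add, map_smul, smul_mul_assoc, smul_add])
    (by intros; simp only [map_add, mul_add]; ring)
    (by intros; simp only [map_add, map_smul, mul_smul_comm, smul_add])

variable (σ : F ≃ₐ[k] F) (r : ℕ)

theorem hermitianPolar_apply (x z : F) :
    hermitianPolar σ r x z = Algebra.trace k F ((σ ^ r) x * z + x * (σ ^ r) z) := rfl

theorem hermitianForm_add (x z : F) :
    hermitianForm σ r (x + z) = hermitianForm σ r x + hermitianForm σ r z
      + hermitianPolar σ r x z := by
  simp only [hermitianForm, hermitianPolar_apply, ← map_add]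
  congr 1
  simp only [map_add]; ring

theorem hermitianPolar_comm (x z : F) : hermitianPolar σ r x z = hermitianPolar σ r z x := by
  simp only [hermitianPolar_apply]; congr 1; ring

theorem trace_algEquiv_apply (σ : F ≃ₐ[k] F) (x : F) :
    Algebra.trace k F (σ x) = Algebra.trace k F x :=
  Algebra.trace_eq_of_algEquiv σ x

theorem hermitianPolar_eq (x z : F) :
    hermitianPolar σ r x z = Algebra.trace k F (((σ ^ (2 * r)) x + x) * (σ ^ r) z) := by
  rw [hermitianPolar_apply, map_add, ← trace_algEquiv_apply (σ ^ r) ((σ ^ r) x * z), ← map_add,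
    map_mul, two_mul, pow_add, AlgEquiv.mul_apply, add_mul]

theorem hermitianPolar_pow (m : ℕ) (x z : F) :
    hermitianPolar σ r ((σ ^ m) x) ((σ ^ m) z) = hermitianPolar σ r x z := by
  simp only [hermitianPolar_apply]
  rw [← trace_algEquiv_apply (σ ^ m) ((σ ^ r) x * z + x * (σ ^ r) z)]
  simp only [map_add, map_mul, ← AlgEquiv.mul_apply, ← pow_add, add_comm]

theorem eq_of_forall_trace_mul_eq [FiniteDimensional k F] [Algebra.IsSeparable k F] {x y : F}
    (h : ∀ z, Algebra.trace k F (x * z) = Algebra.trace k F (y * z)) : x = y := by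
  refine sub_eq_zero.1 ((traceForm_nondegenerate k F).1 (x - y) fun z => ?_)
  rw [Algebra.traceForm_apply, sub_mul, map_sub, h, sub_self]

theorem pow_gcd_apply_eq {a b : ℕ} {x : F} (ha : (σ ^ a) x = x) (hb : (σ ^ b) x = x) :
    (σ ^ a.gcd b) x = x := by
  rw [AlgEquiv.coe_pow] at *
  exact Function.IsPeriodicPt.gcd ha hb

variable [CharP F 2] {m : ℕ}

theorem pow_two_apply_of_hermitianPolar_eq_zero [FiniteDimensional k F]
    [Algebra.IsSeparable k F] (hm : Odd m) (hσ : σ ^ (2 * m) = 1) {x : F}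
    (h : hermitianPolar σ (m + 2) x = 0) : (σ ^ 2) x = x := by
  have h1 : (σ ^ (2 * (m + 2))) x + x = 0 := by
    refine eq_of_forall_trace_mul_eq (k := k) fun z => ?_
    obtain ⟨z, rfl⟩ := (σ ^ (m + 2)).surjective z
    rw [← hermitianPolar_eq, h]; simp
  rw [CharTwo.add_eq_zero, show 2 * (m + 2) = 2 * m + 4 by ring, pow_add, hσ, one_mul] at h1
  have h2 : (σ ^ (2 * m)) x = x := by rw [hσ]; rfl
  have := pow_gcd_apply_eq σ h1 h2
  rwa [show 4 = 2 * 2 from rfl, Nat.gcd_mul_left,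
    Nat.Coprime.gcd_eq_one (Nat.coprime_two_left.2 hm), mul_one] at this

theorem exists_add_pow_apply_eq_one (hm : σ ^ m ≠ 1) (hσ : σ ^ (2 * m) = 1) :
    ∃ ω : F, ω + (σ ^ m) ω = 1 := by
  obtain ⟨z, hz⟩ : ∃ z, (σ ^ m) z ≠ z := by
    by_contra! h
    exact hm (AlgEquiv.ext h)
  have h0 : z + (σ ^ m) z ≠ 0 := fun h => hz (CharTwo.add_eq_zero.1 h).symm
  have h1 : (σ ^ m) ((σ ^ m) z) = z := by
    rw [← AlgEquiv.mul_apply, ← pow_add, ← two_mul, hσ]; rfl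
  refine ⟨z / (z + (σ ^ m) z), ?_⟩
  rw [map_div₀, map_add, h1, add_comm _ z, ← add_div, div_self h0]

theorem trace_eq_zero_of_pow_apply_eq (hm : σ ^ m ≠ 1) (hσ : σ ^ (2 * m) = 1) {x : F}
    (hx : (σ ^ m) x = x) : Algebra.trace k F x = 0 := by
  obtain ⟨ω, hω⟩ := exists_add_pow_apply_eq_one σ hm hσ
  have : x = x * ω + (σ ^ m) (x * ω) := by rw [map_mul, hx, ← mul_add, hω, mul_one]
  have : CharP k 2 := (algebraMap k F).charP (algebraMap k F).injective 2
  rw [‹x = _›, map_add, trace_algEquiv_apply, CharTwo.add_self_eq_zero]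

theorem hermitianForm_eq_zero_of_pow_two_apply_eq (hm : Odd m) (hm1 : σ ^ m ≠ 1)
    (hσ : σ ^ (2 * m) = 1) {x : F} (hx : (σ ^ 2) x = x) : hermitianForm σ (m + 2) x = 0 := by
  refine trace_eq_zero_of_pow_apply_eq σ hm1 hσ ?_
  have h1 : (σ ^ m) x = σ x := by
    obtain ⟨j, rfl⟩ := hm
    rw [AlgEquiv.coe_pow] at hx
    rw [pow_succ', AlgEquiv.mul_apply, AlgEquiv.coe_pow, (Function.IsPeriodicPt.mul_const hx j).eq]
  have h2 : σ (σ x) = x := by simpa [pow_two] using hx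
  rw [map_mul, pow_add, AlgEquiv.mul_apply, hx, h1, ← AlgEquiv.mul_apply, ← pow_succ, pow_succ',
    AlgEquiv.mul_apply, h1, h2, mul_comm]

theorem hermitianForm_eq_zero_of_add_pow_apply (hm : Odd m) (hm1 : σ ^ m ≠ 1)
    (hσ : σ ^ (2 * m) = 1)
    (htr : ∀ x, algebraMap k F (Algebra.trace k F x) = ∑ i ∈ Finset.range (2 * m), (σ ^ i) x)
    {x : F} {c : k} (hx : x + (σ ^ m) x = algebraMap k F c) :
    hermitianForm σ (m + 2) x = 0 := by
  have : CharP k 2 := (algebraMap k F).charP (algebraMap k F).injective 2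
  have hinj := (algebraMap k F).injective
  have hc : Algebra.trace k F x = c := by
    apply hinj
    rw [htr, two_mul, Finset.sum_range_add, ← Finset.sum_add_distrib]
    have : ∀ i ∈ Finset.range m, (σ ^ i) x + (σ ^ (m + i)) x = algebraMap k F c := fun i _ => by
      rw [add_comm m i, pow_add, AlgEquiv.mul_apply, ← map_add, hx, AlgEquiv.commutes]
    rw [Finset.sum_congr rfl this, Finset.sum_const, Finset.card_range, nsmul_eq_mul,
      CharTwo.natCast_eq_mod, Nat.odd_iff.1 hm, Nat.cast_one, one_mul]
  have hsq : Algebra.trace k F (x * x) = c * c := by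
    apply hinj
    rw [(algebraMap k F).map_mul, ← hc, htr, htr, ← pow_two, ← pow_two, CharTwo.sum_sq]
    simp only [map_pow]
  have hx' : (σ ^ m) x = algebraMap k F c + x := by
    rw [← hx, add_right_comm, CharTwo.add_self_eq_zero, zero_add]
  obtain ⟨e, he⟩ : ∃ e, e = x + σ x := ⟨_, rfl⟩
  have hem : (σ ^ m) e = e := by
    have : (σ ^ m) (σ x) = σ ((σ ^ m) x) := by
      rw [← AlgEquiv.mul_apply, ← AlgEquiv.mul_apply, ← pow_succ, ← pow_succ']
    rw [he, map_add, this, hx', map_add, AlgEquiv.commutes, add_add_add_comm,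
      CharTwo.add_self_eq_zero, zero_add]
  have hem' : (σ ^ m) (σ e) = σ e := by
    rw [← AlgEquiv.mul_apply, ← pow_succ, pow_succ', AlgEquiv.mul_apply, hem]
  have hσx : σ x = e + x := by rw [he, add_right_comm, CharTwo.add_self_eq_zero, zero_add]
  have h1 : (σ ^ (m + 2)) x = algebraMap k F c + σ e + e + x := by
    rw [add_comm m 2, pow_add, AlgEquiv.mul_apply, hx', map_add, AlgEquiv.commutes, pow_two,
      AlgEquiv.mul_apply, hσx, map_add, hσx]
    ring
  have h2 : Algebra.trace k F (σ e * x) = Algebra.trace k F (e * x) := by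
    have h3 : Algebra.trace k F (σ e * e) = 0 :=
      trace_eq_zero_of_pow_apply_eq σ hm1 hσ (by rw [map_mul, hem, hem'])
    rw [← trace_algEquiv_apply σ (e * x), map_mul σ, hσx, mul_add, map_add, h3, zero_add]
  rw [hermitianForm, h1, add_mul, add_mul, add_mul, map_add, map_add, map_add, h2, hsq,
    ← Algebra.smul_def, map_smul, hc, smul_eq_mul, add_assoc (c * c), CharTwo.add_self_eq_zero,
    add_zero, CharTwo.add_self_eq_zero]

/-- The fixed points of `σ ^ m`, as a subspace. -/
def fixedSubspace (σ : F ≃ₐ[k] F) (m : ℕ) : Submodule k F :=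
  LinearMap.ker ((σ ^ m).toLinearMap - LinearMap.id)

omit [CharP F 2] in
theorem mem_fixedSubspace {x : F} : x ∈ fixedSubspace σ m ↔ (σ ^ m) x = x := by
  simp [fixedSubspace, sub_eq_zero]

theorem add_mul_inj_of_mem_fixedSubspace {ω a b a' b' : F} (hω : ω + (σ ^ m) ω = 1)
    (ha : (σ ^ m) a = a) (ha' : (σ ^ m) a' = a') (hb : (σ ^ m) b = b) (hb' : (σ ^ m) b' = b')
    (h : a + b * ω = a' + b' * ω) : a = a' ∧ b = b' := by
  have key : ∀ a b, (σ ^ m) a = a → (σ ^ m) b = b →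
      (a + b * ω) + (σ ^ m) (a + b * ω) = b := fun a b ha hb => by
    rw [map_add, map_mul, ha, hb, add_add_add_comm, CharTwo.add_self_eq_zero, zero_add,
      ← mul_add, hω, mul_one]
  have hbb : b = b' := by rw [← key a b ha hb, h, key a' b' ha' hb']
  subst hbb
  exact ⟨add_right_cancel h, rfl⟩

open Classical Finset in
theorem sq_card_fixedSubspace [Fintype F] (hm1 : σ ^ m ≠ 1) (hσ : σ ^ (2 * m) = 1) :
    Fintype.card (fixedSubspace σ m) ^ 2 = Fintype.card F := by
  obtain ⟨ω, hω⟩ := exists_add_pow_apply_eq_one σ hm1 hσ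
  have hσ' : ∀ x, (σ ^ m) ((σ ^ m) x) = x := fun x => by
    rw [← AlgEquiv.mul_apply, ← pow_add, ← two_mul, hσ]; rfl
  rw [pow_two, ← Fintype.card_prod]
  refine Fintype.card_of_bijective (f := fun p => (p.1 : F) + p.2 * ω) ⟨?_, fun x => ?_⟩
  · rintro ⟨⟨a, ha⟩, ⟨b, hb⟩⟩ ⟨⟨a', ha'⟩, ⟨b', hb'⟩⟩ h
    rw [mem_fixedSubspace] at ha ha' hb hb'
    obtain ⟨rfl, rfl⟩ := add_mul_inj_of_mem_fixedSubspace σ hω ha ha' hb hb' h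
    rfl
  · have hb : (σ ^ m) (x + (σ ^ m) x) = x + (σ ^ m) x := by rw [map_add, hσ', add_comm]
    refine ⟨⟨⟨x + (x + (σ ^ m) x) * ω, (mem_fixedSubspace σ).2 ?_⟩,
      ⟨x + (σ ^ m) x, (mem_fixedSubspace σ).2 hb⟩⟩, ?_⟩
    · have hω' : (σ ^ m) ω = 1 + ω := by
        rw [← hω, add_right_comm, CharTwo.add_self_eq_zero, zero_add]
      rw [map_add, map_mul, hb, hω', mul_add, mul_one, ← add_assoc, add_comm x,
        ← add_assoc, CharTwo.add_self_eq_zero, zero_add]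
    · simp only [add_assoc, CharTwo.add_self_eq_zero, add_zero]

open Classical Finset in
theorem card_filter_hermitianForm_eq [Fintype k] [Fintype F] (hm : Odd m) (hm1 : σ ^ m ≠ 1)
    (hσ : σ ^ (2 * m) = 1)
    (htr : ∀ x, algebraMap k F (Algebra.trace k F x) = ∑ i ∈ Finset.range (2 * m), (σ ^ i) x)
    (hfix : ∀ x, σ x = x → ∃ c, algebraMap k F c = x) (c : k) :
    Fintype.card k * #{x | hermitianForm σ (m + 2) x = c} +
        Fintype.card k * Fintype.card (fixedSubspace σ m) =
      Fintype.card F + if c = 0 then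
        Fintype.card k * (Fintype.card k * Fintype.card (fixedSubspace σ m)) else 0 := by
  have hσ' : ∀ x, (σ ^ m) ((σ ^ m) x) = x := fun x => by
    rw [← AlgEquiv.mul_apply, ← pow_add, ← two_mul, hσ]; rfl
  set A := fixedSubspace σ m with hA
  set S : Finset F := {x | ∃ c, x + (σ ^ m) x = algebraMap k F c} with hS
  have hSQ : ∀ x ∈ S, hermitianForm σ (m + 2) x = 0 := fun x hx => by
    obtain ⟨c, hc⟩ := (mem_filter.1 hx).2
    exact hermitianForm_eq_zero_of_add_pow_apply σ hm hm1 hσ htr hc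
  have hAQ : ∀ a ∈ A, hermitianForm σ (m + 2) a = 0 := fun a ha => by
    refine hermitianForm_eq_zero_of_add_pow_apply σ hm hm1 hσ htr (c := 0) ?_
    rw [(mem_fixedSubspace σ).1 ha, CharTwo.add_self_eq_zero, map_zero]
  let g : F → A →ₗ[k] k := fun v => (hermitianPolar σ (m + 2) v).comp A.subtype
  have hg : ∀ v, g v = 0 ↔ v ∈ S := by
    intro v
    constructor
    · intro h
      have hw : hermitianPolar σ (m + 2) (v + (σ ^ m) v) = 0 := by
        ext z
        have h1 : z + (σ ^ m) z ∈ A := by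
          rw [hA, mem_fixedSubspace, map_add, hσ', add_comm]
        have h2 : hermitianPolar σ (m + 2) v (z + (σ ^ m) z) = 0 := DFunLike.congr_fun h ⟨_, h1⟩
        rw [map_add, ← hermitianPolar_pow σ _ m v ((σ ^ m) z), hσ'] at h2
        rwa [map_add, LinearMap.add_apply]
      have h2 := pow_two_apply_of_hermitianPolar_eq_zero σ hm hσ hw
      have h3 : (σ ^ m) (v + (σ ^ m) v) = v + (σ ^ m) v := by rw [map_add, hσ', add_comm]
      have h4 := pow_gcd_apply_eq σ h2 h3
      rw [Nat.Coprime.gcd_eq_one (Nat.coprime_two_left.2 hm), pow_one] at h4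
      obtain ⟨c, hc⟩ := hfix _ h4
      exact mem_filter.2 ⟨mem_univ _, c, hc.symm⟩
    · intro hv
      ext ⟨a, ha⟩
      have hva : v + a ∈ S := by
        obtain ⟨c, hc⟩ := (mem_filter.1 hv).2
        refine mem_filter.2 ⟨mem_univ _, c, ?_⟩
        rw [map_add, (mem_fixedSubspace σ).1 ha, add_add_add_comm, hc,
          CharTwo.add_self_eq_zero, add_zero]
      have := hermitianForm_add σ (m + 2) v a
      rw [hSQ _ hva, hSQ _ hv, hAQ _ ha, zero_add, zero_add] at this
      exact this.symm
  have hScard : #S = Fintype.card k * Fintype.card A := by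
    obtain ⟨ω, hω⟩ := exists_add_pow_apply_eq_one σ hm1 hσ
    rw [mul_comm, ← Fintype.card_prod, ← card_univ]
    symm
    refine card_bij (fun p _ => (p.1 : F) + algebraMap k F p.2 * ω) ?_ ?_ ?_
    · rintro ⟨⟨a, ha⟩, c⟩ -
      rw [mem_fixedSubspace] at ha
      refine mem_filter.2 ⟨mem_univ _, c, ?_⟩
      simp only [map_add, map_mul, AlgEquiv.commutes, ha]
      rw [add_add_add_comm, CharTwo.add_self_eq_zero, zero_add, ← mul_add, hω, mul_one]
    · rintro ⟨⟨a, ha⟩, c⟩ - ⟨⟨a', ha'⟩, c'⟩ - h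
      rw [mem_fixedSubspace] at ha ha'
      obtain ⟨rfl, h2⟩ := add_mul_inj_of_mem_fixedSubspace σ hω ha ha'
        (AlgEquiv.commutes _ c) (AlgEquiv.commutes _ c') h
      rw [(algebraMap k F).injective h2]
    · intro x hx
      obtain ⟨c, hc⟩ := (mem_filter.1 hx).2
      refine ⟨⟨⟨x + algebraMap k F c * ω, (mem_fixedSubspace σ).2 ?_⟩, c⟩, mem_univ _, ?_⟩
      · have hω' : (σ ^ m) ω = 1 + ω := by
          rw [← hω, add_right_comm, CharTwo.add_self_eq_zero, zero_add]
        have hx' : (σ ^ m) x = algebraMap k F c + x := by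
          rw [← hc, add_right_comm, CharTwo.add_self_eq_zero, zero_add]
        rw [map_add, map_mul, AlgEquiv.commutes, hω', hx', mul_add, mul_one, add_add_add_comm,
          CharTwo.add_self_eq_zero, zero_add]
      · simp only [add_assoc, CharTwo.add_self_eq_zero, add_zero]
  have h := card_mul_card_filter_add_card A (hermitianForm σ (m + 2)) g (fun v a => by
    rw [hermitianForm_add, hAQ _ a.2, add_zero]; rfl) c
  have h1 : #{v | g v = 0} = #S := by simp only [hg, filter_univ_mem]
  have h2 : #{v | g v = 0 ∧ hermitianForm σ (m + 2) v = c} = if c = 0 then #S else 0 := by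
    have : ∀ v, (g v = 0 ∧ hermitianForm σ (m + 2) v = c) ↔ v ∈ S ∧ c = 0 := fun v => by
      rw [hg]
      exact and_congr_right fun hv => by rw [hSQ v hv, eq_comm]
    simp only [this]
    split_ifs with hc <;> simp [hc]
  rw [h1, h2, hScard] at h
  rw [h]
  split_ifs <;> simp

open Classical Finset in
theorem card_mul_card_filter_hermitianForm_add_trace_eq [Fintype k] [Fintype F] (hm : Odd m)
    (hm1 : σ ^ m ≠ 1) (hσ : σ ^ (2 * m) = 1) {B : F}
    (hB : ¬ ∃ x, (σ ^ (2 * (m + 2))) x + x = (σ ^ (m + 2)) B) (c : k) :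
    Fintype.card k * #{x | hermitianForm σ (m + 2) x + Algebra.trace k F (B * x) = c} =
      Fintype.card F := by
  let β : F →ₗ[k] F →ₗ[k] k := hermitianPolar σ (m + 2)
  let L : F →ₗ[k] k := (Algebra.trace k F).comp (LinearMap.mulLeft k B)
  have hL : ∀ x, L x = Algebra.trace k F (B * x) := fun x => rfl
  obtain ⟨ρ, hρ, hρB⟩ : ∃ ρ ∈ LinearMap.ker β, L ρ ≠ 0 := by
    by_contra! h
    have h1 : L ∈ (LinearMap.ker β).dualAnnihilator := (Submodule.mem_dualAnnihilator _).2 h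
    rw [← LinearMap.range_dualMap_eq_dualAnnihilator_ker] at h1
    obtain ⟨φ, hφ⟩ := h1
    obtain ⟨x, rfl⟩ := (Module.evalEquiv k F).surjective φ
    refine hB ⟨x, eq_of_forall_trace_mul_eq (k := k) fun z => ?_⟩
    obtain ⟨z, rfl⟩ := (σ ^ (m + 2)).surjective z
    rw [← hermitianPolar_eq, ← map_mul, trace_algEquiv_apply, ← hL, ← hφ, hermitianPolar_comm]
    rfl
  rw [LinearMap.mem_ker] at hρ
  have hβ : ∀ z, β z ρ = 0 := fun z => by
    rw [show β z ρ = β ρ z from hermitianPolar_comm _ _ _ _, hρ]; rfl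
  have hQ : ∀ a ∈ Submodule.span k {ρ}, hermitianForm σ (m + 2) a = 0 := fun a ha => by
    obtain ⟨t, rfl⟩ := Submodule.mem_span_singleton.1 ha
    refine hermitianForm_eq_zero_of_pow_two_apply_eq σ hm hm1 hσ ?_
    exact pow_two_apply_of_hermitianPolar_eq_zero σ hm hσ
      (show β (t • ρ) = 0 by rw [map_smul, hρ, smul_zero])
  have h := card_mul_card_filter_add_card (Submodule.span k {ρ})
    (fun x => hermitianForm σ (m + 2) x + L x)
    (fun _ => L.comp (Submodule.span k {ρ}).subtype) (fun v a => by
      obtain ⟨t, ht⟩ := Submodule.mem_span_singleton.1 a.2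
      have : hermitianPolar σ (m + 2) v a = 0 := by
        rw [← ht, map_smul, show hermitianPolar σ (m + 2) v ρ = 0 from hβ v, smul_zero]
      rw [hermitianForm_add, hQ _ a.2, this, map_add, add_zero, add_zero, ← add_assoc]; rfl) c
  have h0 : L.comp (Submodule.span k {ρ}).subtype ≠ 0 := fun h =>
    hρB (DFunLike.congr_fun h ⟨ρ, Submodule.mem_span_singleton_self ρ⟩)
  simpa [h0, hL] using h

omit [CharP F 2] in
theorem hermitianForm_add_trace_eq {B x₀ : F}
    (hB : (σ ^ (2 * r)) x₀ + x₀ = (σ ^ r) B) (x : F) :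
    hermitianForm σ r x + Algebra.trace k F (B * x) + hermitianForm σ r x₀ =
      hermitianForm σ r (x₀ + x) := by
  rw [hermitianForm_add, hermitianPolar_eq, hB, ← map_mul, trace_algEquiv_apply]
  ring

end

section
variable {k F : Type*} [Field k] [Fintype k] [Field F] [Fintype F] [Algebra k F] [CharP F 2]
  {q m : ℕ} {T : F → F}

omit [Fintype k] [Fintype F] in
theorem trace_mul_add_eq_iff (σ : F ≃ₐ[k] F) (r : ℕ)
    (hT : ∀ z, T z = algebraMap k F (Algebra.trace k F z)) (hqσ : ∀ i x, (σ ^ i) x = x ^ q ^ i)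
    (B C x : F) : T (B * x + C) = T (x ^ (q ^ r + 1)) ↔
      hermitianForm σ r x + Algebra.trace k F (B * x) = Algebra.trace k F C := by
  have : CharP k 2 := (algebraMap k F).charP (algebraMap k F).injective 2
  rw [hT, hT, (algebraMap k F).injective.eq_iff, pow_succ, ← hqσ, map_add, hermitianForm]
  have h (c : k) : c + c = 0 := CharTwo.add_self_eq_zero c
  have hQ := h (Algebra.trace k F ((σ ^ r) x * x))
  have hC := h (Algebra.trace k F C)
  constructor <;> intro h
  · linear_combination h + hQ - hC
  · linear_combination h - hQ + hC

open Classical Finset in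
theorem curve_line_counts_of_algebra (hk : Fintype.card k = q) (hm : Odd m) (hm3 : 3 ≤ m)
    (hF : Fintype.card F = q ^ (2 * m))
    (hT : ∀ z : F, T z = ∑ i ∈ Finset.range (2 * m), z ^ q ^ i) :
    (∀ w, Nat.card {y // T y = T w} = q ^ (2 * m - 1)) ∧
    (∀ B C, (¬ ∃ x : F, x ^ q ^ (2 * (m + 2)) + x = B ^ q ^ (m + 2)) →
      Nat.card {x // T (B * x + C) = T (x ^ (q ^ (m + 2) + 1))} = q ^ (2 * m - 1)) ∧
    (∀ B C, (∃ x : F, x ^ q ^ (2 * (m + 2)) + x = B ^ q ^ (m + 2)) →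
      Nat.card {x // T (B * x + C) = T (x ^ (q ^ (m + 2) + 1))} ≤
        q ^ (2 * m - 1) + q ^ m * (q - 1)) ∧
    (∀ a b, ∃ B C, b = B * a + C ∧ (∃ x : F, x ^ q ^ (2 * (m + 2)) + x = B ^ q ^ (m + 2)) ∧
      Nat.card {x // T (B * x + C) = T (x ^ (q ^ (m + 2) + 1))} =
        q ^ (2 * m - 1) + q ^ m * (q - 1)) := by
  have hq1 : 1 < q := hk ▸ Fintype.one_lt_card
  have hqpos : 0 < q := by omega
  have hrank : Module.finrank k F = 2 * m := by
    have h := Module.card_eq_pow_finrank (K := k) (V := F)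
    rw [hF, hk] at h
    exact (Nat.pow_right_injective hq1 h).symm
  have hT' : ∀ z, T z = algebraMap k F (Algebra.trace k F z) := fun z => by
    rw [hT, FiniteField.algebraMap_trace_eq_sum_pow, hrank, Nat.card_eq_fintype_card, hk]
  let σ : F ≃ₐ[k] F := FiniteField.frobeniusAlgEquivOfAlgebraic k F
  have hqσ : ∀ i x, (σ ^ i) x = x ^ q ^ i := fun i x => by
    rw [AlgEquiv.coe_pow, FiniteField.coe_frobeniusAlgEquivOfAlgebraic_iterate, hk]
  have hord : orderOf σ = 2 * m := by
    rw [FiniteField.orderOf_frobeniusAlgEquivOfAlgebraic, hrank]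
  have hσ : σ ^ (2 * m) = 1 := hord ▸ pow_orderOf_eq_one σ
  have hσm : σ ^ m ≠ 1 := fun h => by
    have := Nat.le_of_dvd (by omega) (orderOf_dvd_of_pow_eq_one h)
    omega
  have htr : ∀ x, algebraMap k F (Algebra.trace k F x) =
      ∑ i ∈ Finset.range (2 * m), (σ ^ i) x := fun x => by
    simp only [← hT', hT, hqσ]
  have hfix : ∀ x, σ x = x → ∃ c, algebraMap k F c = x := by
    intro x hx
    refine (IsGalois.mem_range_algebraMap_iff_fixed (F := k) (E := F) x).2 fun τ => ?_
    obtain ⟨i, rfl⟩ := (FiniteField.bijective_frobeniusAlgEquivOfAlgebraic_pow k F).2 τ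
    change (σ ^ (i : ℕ)) x = x
    rw [AlgEquiv.coe_pow]
    exact Function.iterate_fixed hx _
  have hA : Fintype.card (fixedSubspace σ m) = q ^ m := by
    refine Nat.pow_left_injective two_ne_zero ?_
    change _ ^ 2 = _ ^ 2
    rw [sq_card_fixedSubspace σ hσm hσ, hF, ← pow_mul, mul_comm]
  have hpow : q ^ (2 * m) = q * q ^ (2 * m - 1) := by
    rw [← pow_succ', Nat.sub_add_cancel (by omega)]
  have hN := card_filter_hermitianForm_eq σ hm hσm hσ htr hfix
  simp only [hk, hA, hF] at hN
  have hN0 : #{x | hermitianForm σ (m + 2) x = 0} = q ^ (2 * m - 1) + q ^ m * (q - 1) := by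
    have h := hN 0
    rw [if_pos rfl, hpow] at h
    obtain ⟨p, rfl⟩ : ∃ p, q = p + 1 := ⟨q - 1, by omega⟩
    rw [Nat.add_sub_cancel]
    refine Nat.eq_of_mul_eq_mul_left hqpos ?_
    linarith
  have hNle : ∀ c, #{x | hermitianForm σ (m + 2) x = c} ≤
      q ^ (2 * m - 1) + q ^ m * (q - 1) := by
    intro c
    by_cases hc : c = 0
    · rw [hc, hN0]
    · have h := hN c
      rw [if_neg hc, hpow, add_zero, ← mul_add] at h
      have := Nat.eq_of_mul_eq_mul_left hqpos h
      omega
  have hQsurj : ∀ c, ∃ x, hermitianForm σ (m + 2) x = c := by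
    intro c
    have h := hN c
    have h1 : q * q ^ m < q ^ (2 * m) := by
      rw [← pow_succ']
      exact Nat.pow_lt_pow_right hq1 (by omega)
    have h2 : 0 < #{x | hermitianForm σ (m + 2) x = c} := by
      rw [Nat.pos_iff_ne_zero]
      intro h0
      rw [h0] at h
      omega
    obtain ⟨x, hx⟩ := card_pos.1 h2
    exact ⟨x, (mem_filter.1 hx).2⟩
  have hiff := fun B C x => trace_mul_add_eq_iff σ (m + 2) hT' hqσ B C x
  have hH : ∀ B x, x ^ q ^ (2 * (m + 2)) + x = B ^ q ^ (m + 2) ↔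
      (σ ^ (2 * (m + 2))) x + x = (σ ^ (m + 2)) B := fun B x => by rw [hqσ, hqσ]
  have hcount : ∀ B C x₀, (σ ^ (2 * (m + 2))) x₀ + x₀ = (σ ^ (m + 2)) B →
      Nat.card {x // T (B * x + C) = T (x ^ (q ^ (m + 2) + 1))} =
        #{x | hermitianForm σ (m + 2) x =
          Algebra.trace k F C + hermitianForm σ (m + 2) x₀} := by
    intro B C x₀ h
    simp only [hiff]
    rw [Nat.card_eq_fintype_card, Fintype.card_subtype]
    have key : ∀ x, hermitianForm σ (m + 2) x + Algebra.trace k F (B * x) =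
        Algebra.trace k F C ↔ hermitianForm σ (m + 2) (x₀ + x) =
          Algebra.trace k F C + hermitianForm σ (m + 2) x₀ := fun x => by
      rw [← hermitianForm_add_trace_eq σ _ h, add_left_inj]
    simp only [key]
    exact card_bij (fun v _ => x₀ + v) (by simp) (by simp)
      (fun v hv => ⟨v - x₀, by simpa using hv, by simp⟩)
  refine ⟨fun w => ?_, fun B C hB => ?_, ?_, fun a b => ?_⟩
  · have h0 : Algebra.trace k F ≠ 0 := fun h => by
      obtain ⟨x, hx⟩ := Algebra.trace_surjective k F 1
      rw [h] at hx
      exact zero_ne_one hx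
    have h := LinearMap.card_mul_card_filter_eq h0 (Algebra.trace k F w)
    simp only [hT', (algebraMap k F).injective.eq_iff]
    rw [Nat.card_eq_fintype_card, Fintype.card_subtype]
    refine Nat.eq_of_mul_eq_mul_left hqpos ?_
    rw [← hpow, ← hF, ← h, hk]
  · simp only [hH] at hB
    have h := card_mul_card_filter_hermitianForm_add_trace_eq σ hm hσm hσ hB
      (Algebra.trace k F C)
    simp only [hiff]
    rw [Nat.card_eq_fintype_card, Fintype.card_subtype]
    refine Nat.eq_of_mul_eq_mul_left hqpos ?_
    rw [← hpow, ← hF, ← h, hk]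
  · rintro B C ⟨x₀, h⟩
    rw [hcount B C x₀ ((hH _ _).1 h)]
    exact hNle _
  · obtain ⟨y, hy⟩ := hQsurj (Algebra.trace k F b + hermitianForm σ (m + 2) a)
    obtain ⟨x₀, rfl⟩ : ∃ x₀, y = x₀ + a := ⟨y - a, by ring⟩
    obtain ⟨B, hB⟩ := (σ ^ (m + 2)).surjective ((σ ^ (2 * (m + 2))) x₀ + x₀)
    refine ⟨B, b - B * a, by ring, ⟨x₀, (hH _ _).2 hB.symm⟩, ?_⟩
    rw [hcount B _ x₀ hB.symm, ← hN0]
    rw [← hermitianForm_add_trace_eq σ _ hB.symm] at hy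
    have : CharP k 2 := (algebraMap k F).charP (algebraMap k F).injective 2
    have hz : Algebra.trace k F (b - B * a) + hermitianForm σ (m + 2) x₀ = 0 := by
      rw [map_sub]
      have h3 : hermitianForm σ (m + 2) x₀ + hermitianForm σ (m + 2) x₀ = 0 :=
        CharTwo.add_self_eq_zero _
      linear_combination h3 - hy
    rw [hz]

end

theorem exists_algebra_card_eq {F : Type*} [Field F] [Fintype F] {n ℓ : ℕ} (hn : n ≠ 0)
    (hF : Fintype.card F = (2 ^ n) ^ ℓ) :
    CharP F 2 ∧ ∃ (k : Type) (_ : Field k) (_ : Fintype k) (_ : Algebra k F),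
      Fintype.card k = 2 ^ n := by
  rw [← pow_mul] at hF
  have hchar : CharP F 2 := charP_of_card_eq_prime_pow hF
  let : Fintype (GaloisField 2 n) := Fintype.ofFinite _
  refine ⟨hchar, GaloisField 2 n, inferInstance, inferInstance, ?_⟩
  let : Algebra (ZMod 2) F := ZMod.algebra F 2
  have hfin : Module.finrank (ZMod 2) F = n * ℓ := by
    have h := Module.card_eq_pow_finrank (K := ZMod 2) (V := F)
    rw [hF, ZMod.card] at h
    exact (Nat.pow_right_injective le_rfl h).symm
  obtain ⟨φ⟩ := FiniteField.nonempty_algHom_of_finrank_dvd (F := ZMod 2) (K := GaloisField 2 n)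
    (L := F) (by rw [GaloisField.finrank 2 hn, hfin]; exact dvd_mul_right _ _)
  exact ⟨φ.toRingHom.toAlgebra, by rw [← Nat.card_eq_fintype_card, GaloisField.card 2 n hn]⟩

theorem Projectivization.linear_form_rep_eq_zero_iff {F : Type*} [Field F] (α β γ : F)
    (v : Fin 3 → F) (hv : v ≠ 0) :
    α * (mk F v hv).rep 0 + β * (mk F v hv).rep 1 + γ * (mk F v hv).rep 2 = 0 ↔
      α * v 0 + β * v 1 + γ * v 2 = 0 := by
  obtain ⟨a, ha⟩ := exists_smul_eq_mk_rep F v hv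
  rw [← ha]
  simp only [Pi.smul_apply, Units.smul_def, smul_eq_mul]
  rw [show α * (a * v 0) + β * (a * v 1) + γ * (a * v 2) =
    a * (α * v 0 + β * v 1 + γ * v 2) by ring, mul_eq_zero, or_iff_right a.ne_zero]

section
variable {F : Type*} [Field F]

/-- The affine point `(x : y : 1)`. -/
abbrev affinePoint (x y : F) : Projectivization F (Fin 3 → F) :=
  Projectivization.mk F ![x, y, 1] (fun h => one_ne_zero (congrFun h 2))

/-- The point `(1 : B : 0)` of the line at infinity. -/
abbrev slopePoint (B : F) : Projectivization F (Fin 3 → F) :=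
  Projectivization.mk F ![1, B, 0] (fun h => one_ne_zero (congrFun h 0))

variable (F) in
/-- The point `(0 : 1 : 0)`. -/
abbrev verticalPoint : Projectivization F (Fin 3 → F) :=
  Projectivization.mk F ![0, 1, 0] (fun h => one_ne_zero (congrFun h 1))

theorem affinePoint_inj {x y x' y' : F} :
    affinePoint x y = affinePoint x' y' ↔ x = x' ∧ y = y' := by
  rw [Projectivization.mk_eq_mk_iff']
  constructor
  · rintro ⟨a, ha⟩
    have h0 := congrFun ha 0
    have h1 := congrFun ha 1
    have h2 := congrFun ha 2
    simp at h0 h1 h2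
    subst h2
    simp_all
  · rintro ⟨rfl, rfl⟩
    exact ⟨1, by simp⟩

theorem slopePoint_inj {B B' : F} : slopePoint B = slopePoint B' ↔ B = B' := by
  rw [Projectivization.mk_eq_mk_iff']
  constructor
  · rintro ⟨a, ha⟩
    have h0 := congrFun ha 0
    have h1 := congrFun ha 1
    simp at h0 h1
    subst h0
    simp_all
  · rintro rfl
    exact ⟨1, by simp⟩

theorem affinePoint_ne_slopePoint {x y B : F} : affinePoint x y ≠ slopePoint B := by
  rw [Ne, Projectivization.mk_eq_mk_iff']
  rintro ⟨a, ha⟩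
  have h2 := congrFun ha 2
  simp at h2

theorem affinePoint_ne_verticalPoint {x y : F} : affinePoint x y ≠ verticalPoint F := by
  rw [Ne, Projectivization.mk_eq_mk_iff']
  rintro ⟨a, ha⟩
  have h2 := congrFun ha 2
  simp at h2

theorem slopePoint_ne_verticalPoint {B : F} : slopePoint B ≠ verticalPoint F := by
  rw [Ne, Projectivization.mk_eq_mk_iff']
  rintro ⟨a, ha⟩
  have h0 := congrFun ha 0
  simp at h0

theorem exists_eq_affinePoint_or_slopePoint_or_verticalPoint
    (P : Projectivization F (Fin 3 → F)) :
    (∃ x y, P = affinePoint x y) ∨ (∃ B, P = slopePoint B) ∨ P = verticalPoint F := by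
  induction P using Projectivization.ind with | h v hv =>
  by_cases h2 : v 2 = 0
  · right
    by_cases h0 : v 0 = 0
    · right
      rw [Projectivization.mk_eq_mk_iff']
      refine ⟨v 1, ?_⟩
      ext i; fin_cases i <;> simp [h0, h2]
    · left
      refine ⟨v 1 / v 0, ?_⟩
      rw [Projectivization.mk_eq_mk_iff']
      refine ⟨v 0, ?_⟩
      ext i; fin_cases i <;> simp [h2, mul_div_cancel₀, h0]
  · left
    refine ⟨v 0 / v 2, v 1 / v 2, ?_⟩
    rw [Projectivization.mk_eq_mk_iff']
    refine ⟨v 2, ?_⟩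
    ext i; fin_cases i <;> simp [mul_div_cancel₀, h2]

open Classical in
theorem natCard_projective_plane_set [Finite F] (p : F → F → Prop) (s : F → Prop) (t : Prop) :
    Nat.card {P : Projectivization F (Fin 3 → F) // (∃ x y, p x y ∧ P = affinePoint x y) ∨
      (∃ B, s B ∧ P = slopePoint B) ∨ (t ∧ P = verticalPoint F)} =
    Nat.card {z : F × F // p z.1 z.2} + Nat.card {B // s B} + if t then 1 else 0 := by
  have ht : Nat.card {_u : Unit // t} = if t then 1 else 0 := by
    split_ifs with h <;> simp [h]
  rw [← ht, ← Nat.card_sum, ← Nat.card_sum]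
  symm
  refine Nat.card_congr (Equiv.ofBijective (Sum.elim (Sum.elim
    (fun z => ⟨affinePoint z.1.1 z.1.2, Or.inl ⟨_, _, z.2, rfl⟩⟩)
    (fun B => ⟨slopePoint B.1, Or.inr (Or.inl ⟨_, B.2, rfl⟩)⟩))
    (fun u => ⟨verticalPoint F, Or.inr (Or.inr ⟨u.2, rfl⟩)⟩)) ⟨?_, ?_⟩)
  · rintro ((⟨⟨x, y⟩, h⟩ | ⟨B, h⟩) | ⟨u, h⟩) ((⟨⟨x', y'⟩, h'⟩ | ⟨B', h'⟩) | ⟨u', h'⟩) he <;>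
      simp only [Sum.elim_inl, Sum.elim_inr, Subtype.mk.injEq] at he
    · obtain ⟨rfl, rfl⟩ := affinePoint_inj.1 he
      rfl
    · exact (affinePoint_ne_slopePoint he).elim
    · exact (affinePoint_ne_verticalPoint he).elim
    · exact (affinePoint_ne_slopePoint he.symm).elim
    · obtain rfl := slopePoint_inj.1 he
      rfl
    · exact (slopePoint_ne_verticalPoint he).elim
    · exact (affinePoint_ne_verticalPoint he.symm).elim
    · exact (slopePoint_ne_verticalPoint he.symm).elim
    · rfl
  · rintro ⟨P, ⟨x, y, h, rfl⟩ | ⟨B, h, rfl⟩ | ⟨h, rfl⟩⟩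
    · exact ⟨Sum.inl (Sum.inl ⟨(x, y), h⟩), rfl⟩
    · exact ⟨Sum.inl (Sum.inr ⟨B, h⟩), rfl⟩
    · exact ⟨Sum.inr ⟨(), h⟩, rfl⟩

end

open Classical in
theorem natCard_inter_line {F : Type*} [Field F] [Finite F] {p : F → F → Prop} {s : Set F}
    {S : Set (Projectivization F (Fin 3 → F))}
    (hS : ∀ P, P ∈ S ↔ (∃ x y, p x y ∧ P = affinePoint x y) ∨ (∃ B, B ∈ s ∧ P = slopePoint B) ∨
      P = verticalPoint F) (α β γ : F) :
    Nat.card ↥(S ∩ {P : Projectivization F (Fin 3 → F) |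
        α * P.rep 0 + β * P.rep 1 + γ * P.rep 2 = 0}) =
      Nat.card {z : F × F // p z.1 z.2 ∧ α * z.1 + β * z.2 + γ = 0} +
        Nat.card {B // B ∈ s ∧ α + β * B = 0} + if β = 0 then 1 else 0 := by
  rw [← natCard_projective_plane_set (fun x y => p x y ∧ α * x + β * y + γ = 0)]
  refine Nat.card_congr (Equiv.subtypeEquivRight fun P => ?_)
  rw [Set.mem_inter_iff, hS, Set.mem_ofPred_eq]
  rcases exists_eq_affinePoint_or_slopePoint_or_verticalPoint P with
    ⟨x, y, rfl⟩ | ⟨B, rfl⟩ | rfl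
  · simp [Projectivization.linear_form_rep_eq_zero_iff, affinePoint_inj,
      affinePoint_ne_slopePoint, affinePoint_ne_verticalPoint]
  · simp [Projectivization.linear_form_rep_eq_zero_iff, slopePoint_inj,
      affinePoint_ne_slopePoint.symm, slopePoint_ne_verticalPoint]
  · simp [Projectivization.linear_form_rep_eq_zero_iff,
      affinePoint_ne_verticalPoint.symm, slopePoint_ne_verticalPoint.symm]

theorem natCard_nonvertical_line {F : Type*} [Field F] (p : F → F → Prop) {α β γ : F}
    (hβ : β ≠ 0) :
    Nat.card {z : F × F // p z.1 z.2 ∧ α * z.1 + β * z.2 + γ = 0} =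
      Nat.card {x // p x (-(α / β) * x + -(γ / β))} := by
  have key : ∀ x y, α * x + β * y + γ = 0 ↔ y = -(α / β) * x + -(γ / β) := fun x y => by
    constructor
    · intro h
      field_simp
      linear_combination h
    · rintro rfl
      field_simp
      ring
  simp only [key]
  exact Nat.card_congr
    { toFun := fun z => ⟨z.1.1, z.2.2 ▸ z.2.1⟩
      invFun := fun x => ⟨(x.1, _), x.2, rfl⟩
      left_inv := fun z => Subtype.ext (Prod.ext rfl z.2.2.symm)
      right_inv := fun _ => rfl }

theorem natCard_vertical_line {F : Type*} [Field F] (p : F → F → Prop) {α γ : F} (hα : α ≠ 0) :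
    Nat.card {z : F × F // p z.1 z.2 ∧ α * z.1 + 0 * z.2 + γ = 0} =
      Nat.card {y // p (-(γ / α)) y} := by
  have key : ∀ x y, α * x + 0 * y + γ = 0 ↔ x = -(γ / α) := fun x y => by
    rw [zero_mul, add_zero]
    constructor
    · intro h
      field_simp
      linear_combination h
    · rintro rfl
      field_simp
      ring
  simp only [key]
  exact Nat.card_congr
    { toFun := fun z => ⟨z.1.2, by have h := z.2.1; rwa [z.2.2] at h⟩
      invFun := fun y => ⟨(_, y.1), y.2, rfl⟩
      left_inv := fun z => Subtype.ext (Prod.ext z.2.2.symm rfl)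
      right_inv := fun _ => rfl }

/-- Let `q = 2 ^ n`, `ℓ ≥ 6` with `ℓ ≡ 2 (mod 4)` and `r = ℓ/2 + 2`.
Let `K` be the set of rational points of the generalized Hermitian curve and
`H = {B : x^(q^(2r)) + x = B^(q^r)` is solvable`}`.  For every `H₂ ⊆ F_{q^ℓ} ∖ H` of size
`q^(ℓ-1) + q^(r-2)(q-1) - 1`, the pointset `K₃ = K ∪ {(1 : B : 0) : B ∈ H₂}` is a complete
`(N₃, d₂)`-arc with `N₃ = q^(2ℓ-1) + q^(ℓ-1) + q^(r-2)(q-1)` and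
`d₂ = q^(ℓ-1) + q^(r-2)(q-1)`. -/
theorem stmt_19 (n : ℕ) (hn : 1 ≤ n) (q : ℕ) (hq : q = 2 ^ n)
    (ℓ r : ℕ) (hℓ : 6 ≤ ℓ) (hl4 : ℓ % 4 = 2) (hr : r = ℓ / 2 + 2)
    (F : Type) [Field F] [Fintype F] (hF : Fintype.card F = q ^ ℓ)
    (T : F → F) (hT : ∀ z : F, T z = ∑ i ∈ Finset.range ℓ, z ^ q ^ i)
    (K : Set (Projectivization F (Fin 3 → F)))
    (hK : K = {P | ∃ x y : F, T y = T (x ^ (q ^ r + 1)) ∧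
          P = Projectivization.mk F ![x, y, 1]
            (fun h => one_ne_zero (congrFun h 2))} ∪
        {Projectivization.mk F ![0, 1, 0]
            (fun h => one_ne_zero (congrFun h 1))})
    (H : Set F) (hH : H = {B : F | ∃ x : F, x ^ q ^ (2 * r) + x = B ^ q ^ r}) :
    ∀ H₂ : Set F, H₂ ⊆ Hᶜ →
      Nat.card ↥H₂ = q ^ (ℓ - 1) + q ^ (r - 2) * (q - 1) - 1 →
    ∀ K₃ : Set (Projectivization F (Fin 3 → F)),
      K₃ = K ∪ {P | ∃ B ∈ H₂, P = Projectivization.mk F ![1, B, 0]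
            (fun h => one_ne_zero (congrFun h 0))} →
    Nat.card ↥K₃ = q ^ (2 * ℓ - 1) + q ^ (ℓ - 1) + q ^ (r - 2) * (q - 1) ∧
    (∀ α β γ : F, (α, β, γ) ≠ (0, 0, 0) →
      Nat.card ↥(K₃ ∩ {P : Projectivization F (Fin 3 → F) |
          α * P.rep 0 + β * P.rep 1 + γ * P.rep 2 = 0})
        ≤ q ^ (ℓ - 1) + q ^ (r - 2) * (q - 1)) ∧
    (∀ P : Projectivization F (Fin 3 → F), P ∉ K₃ → ∃ α β γ : F,
      (α, β, γ) ≠ (0, 0, 0) ∧ α * P.rep 0 + β * P.rep 1 + γ * P.rep 2 = 0 ∧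
      Nat.card ↥(K₃ ∩ {Q : Projectivization F (Fin 3 → F) |
          α * Q.rep 0 + β * Q.rep 1 + γ * Q.rep 2 = 0})
        = q ^ (ℓ - 1) + q ^ (r - 2) * (q - 1)) := by
  obtain ⟨m, rfl⟩ : ∃ m, ℓ = 2 * m := ⟨ℓ / 2, by omega⟩
  obtain rfl : r = m + 2 := by omega
  have hm : Odd m := Nat.odd_iff.2 (by omega)
  have hq1 : 1 < q := hq ▸ Nat.one_lt_two_pow (by omega)
  obtain ⟨hchar, k, _, _, _, hk⟩ := exists_algebra_card_eq (n := n) (by omega) (hq ▸ hF)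
  obtain ⟨hfib, hbal, hle, hex⟩ :=
    curve_line_counts_of_algebra (hk.trans hq.symm) hm (by omega) hF hT
  rw [Nat.add_sub_cancel]
  intro H₂ hH₂ hcard K₃ hK₃
  have hmem : ∀ P, P ∈ K₃ ↔ (∃ x y, T y = T (x ^ (q ^ (m + 2) + 1)) ∧ P = affinePoint x y) ∨
      (∃ B, B ∈ H₂ ∧ P = slopePoint B) ∨ P = verticalPoint F := by
    intro P
    rw [hK₃, hK, Set.mem_union, Set.mem_union, or_assoc, or_comm (b := P ∈ {P | ∃ B ∈ H₂, _})]
    rfl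
  have hpos : 0 < q ^ m * (q - 1) := Nat.mul_pos (by positivity) (by omega)
  have hcard' : Nat.card {B // B ∈ H₂} + 1 = q ^ (2 * m - 1) + q ^ m * (q - 1) := by
    change Nat.card H₂ + 1 = _
    omega
  have hline := natCard_inter_line hmem
  have hinfinity : ∀ γ : F, γ ≠ 0 →
      Nat.card ↥(K₃ ∩ {P : Projectivization F (Fin 3 → F) |
        0 * P.rep 0 + 0 * P.rep 1 + γ * P.rep 2 = 0}) = q ^ (2 * m - 1) + q ^ m * (q - 1) := by
    intro γ hγ
    rw [hline]
    simpa [hγ] using hcard'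
  have hslope : ∀ α β : F, β ≠ 0 → ∀ B, α + β * B = 0 ↔ B = -(α / β) := by
    intro α β hβ B
    constructor
    · intro h
      field_simp
      linear_combination h
    · rintro rfl
      field_simp
      ring
  refine ⟨?_, ?_, ?_⟩
  · have h := natCard_projective_plane_set (fun x y => T y = T (x ^ (q ^ (m + 2) + 1)))
      (· ∈ H₂) True
    simp only [true_and, ← hmem, if_true] at h
    refine Eq.trans h ?_
    have haff : Nat.card {z : F × F // T z.2 = T (z.1 ^ (q ^ (m + 2) + 1))} =
        q ^ (2 * (2 * m) - 1) := by
      rw [← Nat.card_congr (Equiv.subtypeProdEquivSigmaSubtype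
        (fun x y => T y = T (x ^ (q ^ (m + 2) + 1)))).symm, Nat.card_sigma]
      simp only [hfib, Finset.sum_const, Finset.card_univ, hF, smul_eq_mul, ← pow_add]
      congr 1
      omega
    rw [haff, add_assoc, hcard', ← add_assoc]
  · intro α β γ h0
    by_cases hβ : β = 0
    · subst hβ
      by_cases hα : α = 0
      · subst hα
        exact (hinfinity γ (by simpa using h0)).le
      · rw [hline, natCard_vertical_line (fun x y => T y = T (x ^ (q ^ (m + 2) + 1))) hα, hfib]
        have : IsEmpty {B // B ∈ H₂ ∧ α + 0 * B = 0} := ⟨fun B => hα (by simpa using B.2.2)⟩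
        rw [Nat.card_of_isEmpty, if_pos rfl]
        omega
    · rw [hline, natCard_nonvertical_line (fun x y => T y = T (x ^ (q ^ (m + 2) + 1))) hβ,
        if_neg hβ, add_zero]
      simp only [hslope α β hβ]
      by_cases hB : -(α / β) ∈ H
      · have : IsEmpty {B // B ∈ H₂ ∧ B = -(α / β)} :=
          ⟨fun B => hH₂ B.2.1 (by rw [B.2.2]; exact hB)⟩
        have hempty : Nat.card {B // B ∈ H₂ ∧ B = -(α / β)} = 0 := Nat.card_of_isEmpty
        rw [hempty, add_zero]
        exact hle _ _ (by rwa [hH] at hB)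
      · have : Subsingleton {B // B ∈ H₂ ∧ B = -(α / β)} :=
          ⟨fun B B' => Subtype.ext (B.2.2.trans B'.2.2.symm)⟩
        have h1 := Finite.card_le_one_iff_subsingleton.2 this
        rw [hbal _ _ (by rwa [hH] at hB)]
        omega
  · intro P hP
    rcases exists_eq_affinePoint_or_slopePoint_or_verticalPoint P with
      ⟨a, b, rfl⟩ | ⟨B, rfl⟩ | rfl
    · obtain ⟨B, C, hab, hB, hBC⟩ := hex a b
      refine ⟨-B, 1, -C, by simp, ?_, ?_⟩
      · rw [Projectivization.linear_form_rep_eq_zero_iff]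
        simp only [Matrix.cons_val]
        rw [hab]
        ring
      · rw [hline, natCard_nonvertical_line (fun x y => T y = T (x ^ (q ^ (m + 2) + 1)))
          one_ne_zero, if_neg one_ne_zero, add_zero]
        have : IsEmpty {x // x ∈ H₂ ∧ -B + 1 * x = 0} := ⟨fun x => hH₂ x.2.1 <| by
          have hx : x.1 = B := by linear_combination x.2.2
          rw [hx, hH]
          exact hB⟩
        have hempty : Nat.card {x // x ∈ H₂ ∧ -B + 1 * x = 0} = 0 := Nat.card_of_isEmpty
        rw [hempty, add_zero]
        simpa only [div_one, neg_neg] using hBC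
    · refine ⟨0, 0, 1, by simp, ?_, hinfinity 1 one_ne_zero⟩
      rw [Projectivization.linear_form_rep_eq_zero_iff]
      simp
    · exact (hP ((hmem _).2 (Or.inr (Or.inr rfl)))).elim
end
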